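/- arXiv:2602.11331 — 2 statements merged into one kernel-verified Lean document; each statement's English description precedes it below -/
import Mathlib

section
/- Let G be a finite connected simple graph on at least two vertices with second largest distance eigenvalue λ2(G) < −1/2. Then G is a Ptolemaic graph; moreover, if G has at least one minimal vertex separator of cardinality 2, then G contains the full house or the diamond as an induced subgraph, and every vertex of G adjacent to both vertices of a minimal vertex separator of cardinality 2 is a simplicial vertex. -/
open Polynomial SimpleGraph Sum

noncomputable section

/-- The distance matrix of a graph, with real entries. -/
def distMatrix {V : Type*} [Fintype V] (G : SimpleGraph V) : Matrix V V ℝ :=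
  Matrix.of fun u v => (G.dist u v : ℝ)

/-- The second largest distance eigenvalue: the eigenvalues of the distance matrix
(the roots of its characteristic polynomial, with multiplicity) are sorted in
increasing order, and we take the one at position `card V - 2`. -/
def lambda2 {V : Type*} [Fintype V] [DecidableEq V] (G : SimpleGraph V) : ℝ :=
  ((distMatrix G).charpoly.roots.sort (· ≤ ·)).getD (Fintype.card V - 2) 0

/-- The diameter of a finite graph. -/
def graphDiam {V : Type*} [Fintype V] (G : SimpleGraph V) : ℕ :=
  Finset.univ.sup fun p : V × V => G.dist p.1 p.2

/-- A graph is chordal if every cycle of length at least 4 has a chord. -/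
def IsChordal {V : Type*} (G : SimpleGraph V) : Prop :=
  ∀ (v : V) (c : G.Walk v v), c.IsCycle → 4 ≤ c.length →
    ∃ u w : V, u ∈ c.support ∧ w ∈ c.support ∧ G.Adj u w ∧ s(u, w) ∉ c.edges

/-- Ptolemaic graph: the Ptolemy inequality for the graph distance. -/
def IsPtolemaic {V : Type*} (G : SimpleGraph V) : Prop :=
  ∀ u v w x : V,
    G.dist u v * G.dist w x ≤ G.dist u w * G.dist v x + G.dist u x * G.dist v w

/-- `S` is a `uv`-separator: `u, v ∉ S` and every walk from `u` to `v` meets `S`. -/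
def IsUVSeparator {V : Type*} (G : SimpleGraph V) (S : Finset V) (u v : V) : Prop :=
  u ∉ S ∧ v ∉ S ∧ ∀ w : G.Walk u v, ∃ x ∈ w.support, x ∈ S

/-- `S` is a minimal vertex separator: a minimal `uv`-separator for some pair of
distinct non-adjacent vertices `u, v`. -/
def IsMinimalVertexSeparator {V : Type*} (G : SimpleGraph V) (S : Finset V) : Prop :=
  ∃ u v : V, u ≠ v ∧ ¬ G.Adj u v ∧ IsUVSeparator G S u v ∧
    ∀ T : Finset V, T ⊂ S → ¬ IsUVSeparator G T u v

/-- A connected component `K` of `G − S` is full if every vertex of `S` has a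
neighbour in `K`. -/
def IsFullComponent {V : Type*} (G : SimpleGraph V) (S : Finset V)
    (K : (G.induce ((S : Set V)ᶜ)).ConnectedComponent) : Prop :=
  ∀ a ∈ S, ∃ x : ((S : Set V)ᶜ : Set V),
    (G.induce ((S : Set V)ᶜ)).connectedComponentMk x = K ∧ G.Adj a ↑x

/-- The join `G ⊕ H` of two vertex-disjoint graphs. -/
def graphJoin {α β : Type*} (G : SimpleGraph α) (H : SimpleGraph β) :
    SimpleGraph (α ⊕ β) :=
  SimpleGraph.fromRel fun x y =>
    (∃ a b, x = Sum.inl a ∧ y = Sum.inl b ∧ G.Adj a b) ∨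
    (∃ a b, x = Sum.inr a ∧ y = Sum.inr b ∧ H.Adj a b) ∨
    (x.isLeft ∧ y.isRight)

/-- The disjoint union of two vertex-disjoint graphs. -/
def graphSum {α β : Type*} (G : SimpleGraph α) (H : SimpleGraph β) :
    SimpleGraph (α ⊕ β) :=
  SimpleGraph.fromRel fun x y =>
    (∃ a b, x = Sum.inl a ∧ y = Sum.inl b ∧ G.Adj a b) ∨
    (∃ a b, x = Sum.inr a ∧ y = Sum.inr b ∧ H.Adj a b)

/-- `p` disjoint copies of the complete graph `K_r`. -/
def cliqueCopies (p r : ℕ) : SimpleGraph (Fin p × Fin r) :=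
  SimpleGraph.fromRel fun x y => x.1 = y.1

/-- `q` disjoint copies of `K_1 ⊕ (K_1 ∪ K_2)` (the paw graph): in each copy,
vertex 0 is universal, vertex 1 is otherwise isolated, vertices 2,3 form a `K_2`. -/
def pawCopies (q : ℕ) : SimpleGraph (Fin q × Fin 4) :=
  SimpleGraph.fromRel fun x y => x.1 = y.1 ∧ (x.2 = 0 ∨ (x.2 = 2 ∧ y.2 = 3))

/-- `s` disjoint copies of the path `P_3`. -/
def path3Copies (s : ℕ) : SimpleGraph (Fin s × Fin 3) :=
  SimpleGraph.fromRel fun x y => x.1 = y.1 ∧ ((x.2 = 0 ∧ y.2 = 1) ∨ (x.2 = 1 ∧ y.2 = 2))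

/-- The disjoint union `p_1 K_{r_1} ∪ ⋯ ∪ p_k K_{r_k}`. -/
def multiCliques (k : ℕ) (p r : Fin k → ℕ) :
    SimpleGraph ((i : Fin k) × (Fin (p i) × Fin (r i))) :=
  SimpleGraph.fromRel fun x y =>
    (⟨x.1, x.2.1⟩ : (i : Fin k) × Fin (p i)) = ⟨y.1, y.2.1⟩

/-- The relaxed block star
`K_1 ⊕ ((p_1 K_{r_1} ∪ ⋯ ∪ p_k K_{r_k}) ∪ q (K_1 ⊕ (K_1 ∪ K_2)) ∪ s P_3)`. -/
def relaxedBlockStar (k : ℕ) (p r : Fin k → ℕ) (q s : ℕ) :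
    SimpleGraph (Unit ⊕ (((i : Fin k) × (Fin (p i) × Fin (r i))) ⊕
      ((Fin q × Fin 4) ⊕ (Fin s × Fin 3)))) :=
  graphJoin (⊤ : SimpleGraph Unit)
    (graphSum (multiCliques k p r) (graphSum (pawCopies q) (path3Copies s)))

/-- The graph `G(r,p,q) = K_1 ⊕ (p K_r ∪ q (K_1 ⊕ (K_1 ∪ K_2)))`. -/
def Grpq (r p q : ℕ) : SimpleGraph (Unit ⊕ ((Fin p × Fin r) ⊕ (Fin q × Fin 4))) :=
  graphJoin (⊤ : SimpleGraph Unit) (graphSum (cliqueCopies p r) (pawCopies q))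

/-- The full house graph `K_2 ⊕ (K_1 ∪ K_2)`: vertices 0,1 form the join-`K_2`,
vertex 2 is the `K_1`, vertices 3,4 form the `K_2`. -/
def fullHouse : SimpleGraph (Fin 5) :=
  SimpleGraph.fromRel fun x y => x = 0 ∨ x = 1 ∨ (x = 3 ∧ y = 4)

/-- The diamond graph: `K_4` minus an edge. -/
def diamondGraph : SimpleGraph (Fin 4) :=
  SimpleGraph.fromRel fun x y => x = 0 ∨ x = 1

/-- The path on four vertices. -/
def path4 : SimpleGraph (Fin 4) :=
  SimpleGraph.fromRel fun x y => (x : ℕ) + 1 = (y : ℕ)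

/-- The cycle on four vertices. -/
def cycle4 : SimpleGraph (Fin 4) :=
  SimpleGraph.fromRel fun x y => x + 1 = y

/-- The triple block graph `Pt_2(p,q)`: a full house (on `Fin 5`, with the
join-`K_2` being vertices `a = 0`, `b = 1`) together with `p - 1` further vertices
forming with `a` a clique `K_p` and `q - 1` further vertices forming with `b`
a clique `K_q`. -/
def Pt2Graph (p q : ℕ) : SimpleGraph (Fin 5 ⊕ (Fin (p - 1) ⊕ Fin (q - 1))) :=
  SimpleGraph.fromRel fun x y =>
    match x, y with
    | Sum.inl a, Sum.inl b => a = 0 ∨ a = 1 ∨ (a = 3 ∧ b = 4)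
    | Sum.inl a, Sum.inr (Sum.inl _) => a = 0
    | Sum.inl a, Sum.inr (Sum.inr _) => a = 1
    | Sum.inr (Sum.inl _), Sum.inr (Sum.inl _) => True
    | Sum.inr (Sum.inr _), Sum.inr (Sum.inr _) => True
    | _, _ => False

/-- The nine-vertex graph `Pt_1`: a full house (vertices 0,…,4, join-`K_2` being
`a = 0`, `b = 1`, `K_2` being 3,4), a vertex 5 adjacent only to `a`, a vertex 6
adjacent only to `b`, and vertices 7,8 adjacent to each other and to `b`. -/
def Pt1Graph : SimpleGraph (Fin 9) :=
  SimpleGraph.fromRel fun x y =>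
    (x = 0 ∧ (y = 1 ∨ y = 2 ∨ y = 3 ∨ y = 4 ∨ y = 5)) ∨
    (x = 1 ∧ (y = 2 ∨ y = 3 ∨ y = 4 ∨ y = 6 ∨ y = 7 ∨ y = 8)) ∨
    (x = 3 ∧ y = 4) ∨ (x = 7 ∧ y = 8)

/-- `G` contains an induced subgraph isomorphic to `H`. -/
def HasInducedSubgraph {V W : Type*} (G : SimpleGraph V) (H : SimpleGraph W) : Prop :=
  ∃ s : Set V, Nonempty ((G.induce s) ≃g H)

/-- `G` is isomorphic to a connected induced subgraph of `H`. -/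
def IsoToConnectedInducedSubgraph {V W : Type*} (G : SimpleGraph V)
    (H : SimpleGraph W) : Prop :=
  ∃ s : Set W, (H.induce s).Connected ∧ Nonempty (G ≃g (H.induce s))

/-- A vertex is simplicial if its neighbourhood is a clique. -/
def IsSimplicial {V : Type*} (G : SimpleGraph V) (v : V) : Prop :=
  G.IsClique (G.neighborSet v)

/-- The quintic polynomial `f(r,p,q,x)`. -/
def fpoly (r p q : ℕ) : Polynomial ℝ :=
  X ^ 5 - C (8 * (q : ℝ) + 2 * (r : ℝ) * (p : ℝ) - (r : ℝ) - 8) * X ^ 4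
    - C ((8 * (r : ℝ) + 36) * (q : ℝ) + 15 * (r : ℝ) * (p : ℝ) - 7 * (r : ℝ) - 20) * X ^ 3
    - C ((28 * (r : ℝ) + 52) * (q : ℝ) + 33 * (r : ℝ) * (p : ℝ) - 13 * (r : ℝ) - 18) * X ^ 2
    - C ((24 * (r : ℝ) + 30) * (q : ℝ) + 23 * (r : ℝ) * (p : ℝ) - 5 * (r : ℝ) - 5) * X
    - C ((6 * (r : ℝ) + 6) * (q : ℝ) + 5 * (r : ℝ) * (p : ℝ))

end

theorem distMatrix_isHermitian {V : Type*} [Fintype V] (G : SimpleGraph V) :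
    (distMatrix G).IsHermitian := by
  ext u v
  simp [distMatrix, SimpleGraph.dist_comm]

theorem exists_forall_ne_eigenvalues_lt {V : Type*} [Fintype V] [DecidableEq V] (G : SimpleGraph V)
    (hcard : 2 ≤ Fintype.card V) (hlam : lambda2 G < -1/2) :
    ∃ i : V, ∀ j, j ≠ i → (distMatrix_isHermitian G).eigenvalues j < -1/2 := by
  set hA := distMatrix_isHermitian G
  have hsort : (distMatrix G).charpoly.roots.sort (· ≤ ·) =
      (List.ofFn hA.eigenvalues₀).reverse := by
    rw [hA.roots_charpoly_eq_eigenvalues₀]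
    refine List.Perm.eq_of_pairwise' (r := (· ≤ ·)) (Multiset.pairwise_sort _ _) ?_ ?_
    · rw [List.pairwise_reverse]
      exact List.sortedGE_iff_pairwise.1 hA.eigenvalues₀_antitone.sortedGE_ofFn
    · refine List.Perm.trans ?_ (List.reverse_perm _).symm
      rw [← Multiset.coe_eq_coe, Multiset.sort_eq, Fin.univ_val_map]
      rfl
  have h1 : hA.eigenvalues₀ ⟨1, by omega⟩ < -1/2 := by
    unfold lambda2 at hlam
    rw [hsort, List.getD_eq_getElem _ _ (by simp; omega), List.getElem_reverse] at hlam
    simp only [List.length_ofFn, List.getElem_ofFn] at hlam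
    convert hlam using 3
    omega
  refine ⟨Fintype.equivOfCardEq (Fintype.card_fin _) (⟨0, by omega⟩ : Fin (Fintype.card V)), ?_⟩
  intro j hj
  unfold Matrix.IsHermitian.eigenvalues
  refine lt_of_le_of_lt (hA.eigenvalues₀_antitone ?_) h1
  rw [Fin.le_def]
  by_contra hlt
  apply hj
  rw [← Equiv.symm_apply_eq]
  ext
  simp at hlt ⊢
  omega

/-- The bilinear form `xᵀ (2 D(G) + I) y`. -/
noncomputable def distForm {V : Type*} [Fintype V] (G : SimpleGraph V) (x y : V → ℝ) : ℝ :=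
  2 * (x ⬝ᵥ (distMatrix G).mulVec y) + x ⬝ᵥ y

theorem distForm_self_eq_sum {V : Type*} [Fintype V] [DecidableEq V] (G : SimpleGraph V)
    (x : V → ℝ) :
    distForm G x x = ∑ j, (2 * (distMatrix_isHermitian G).eigenvalues j + 1) *
      (x ⬝ᵥ ⇑((distMatrix_isHermitian G).eigenvectorBasis j)) ^ 2 := by
  set hA := distMatrix_isHermitian G
  set b := hA.eigenvectorBasis
  have key : ∀ y z : V → ℝ, y ⬝ᵥ z = ∑ j, (y ⬝ᵥ ⇑(b j)) * (z ⬝ᵥ ⇑(b j)) := by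
    intro y z
    have := b.sum_inner_mul_inner (WithLp.toLp 2 y) (WithLp.toLp 2 z)
    simp only [EuclideanSpace.inner_eq_star_dotProduct, star_trivial] at this
    rw [dotProduct_comm y z, ← this]
    refine Finset.sum_congr rfl fun j _ => ?_
    rw [dotProduct_comm y]
  have hD : ∀ j, (distMatrix G).mulVec x ⬝ᵥ ⇑(b j) = hA.eigenvalues j * (x ⬝ᵥ ⇑(b j)) := by
    intro j
    rw [dotProduct_comm, Matrix.dotProduct_mulVec, ← Matrix.mulVec_transpose,
      show (distMatrix G).transpose = distMatrix G from hA, hA.mulVec_eigenvectorBasis,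
      smul_dotProduct, dotProduct_comm, smul_eq_mul]
  unfold distForm
  rw [key x ((distMatrix G).mulVec x), key x x, Finset.mul_sum, ← Finset.sum_add_distrib]
  refine Finset.sum_congr rfl fun j _ => ?_
  rw [hD]
  ring

theorem distForm_comm {V : Type*} [Fintype V] (G : SimpleGraph V) (x y : V → ℝ) :
    distForm G x y = distForm G y x := by
  unfold distForm
  rw [dotProduct_comm x y, Matrix.dotProduct_mulVec, ← Matrix.mulVec_transpose,
    show (distMatrix G).transpose = distMatrix G from distMatrix_isHermitian G, dotProduct_comm _ y]

theorem distForm_comb {V : Type*} [Fintype V] (G : SimpleGraph V) (s t : ℝ) (x y z : V → ℝ) :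
    distForm G z (s • x + t • y) = s * distForm G z x + t * distForm G z y := by
  simp only [distForm, Matrix.mulVec_add, Matrix.mulVec_smul, dotProduct_add, dotProduct_smul,
    smul_eq_mul]
  ring

theorem eq_zero_of_distForm_nonneg {V : Type*} [Fintype V] [DecidableEq V] {G : SimpleGraph V}
    {i : V} (hi : ∀ j, j ≠ i → (distMatrix_isHermitian G).eigenvalues j < -1/2) {z : V → ℝ}
    (hz : z ⬝ᵥ ⇑((distMatrix_isHermitian G).eigenvectorBasis i) = 0) (hQ : 0 ≤ distForm G z z) :
    z = 0 := by
  set hA := distMatrix_isHermitian G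
  have hterm : ∀ j ∈ Finset.univ, (2 * hA.eigenvalues j + 1) *
      (z ⬝ᵥ ⇑(hA.eigenvectorBasis j)) ^ 2 ≤ 0 := by
    intro j _
    by_cases hj : j = i
    · subst hj
      simp [hz]
    · exact mul_nonpos_of_nonpos_of_nonneg (by linarith [hi j hj]) (sq_nonneg _)
  rw [distForm_self_eq_sum] at hQ
  have h0 := (Finset.sum_eq_zero_iff_of_nonpos hterm).1 (le_antisymm (Finset.sum_nonpos hterm) hQ)
  have hc : ∀ j, z ⬝ᵥ ⇑(hA.eigenvectorBasis j) = 0 := by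
    intro j
    by_cases hj : j = i
    · rw [hj, hz]
    · rcases mul_eq_zero.1 (h0 j (Finset.mem_univ j)) with h | h
      · linarith [hi j hj]
      · exact pow_eq_zero_iff two_ne_zero |>.1 h
  have : WithLp.toLp 2 z = (0 : EuclideanSpace ℝ V) := by
    rw [← hA.eigenvectorBasis.sum_repr (WithLp.toLp 2 z)]
    refine Finset.sum_eq_zero fun j _ => ?_
    rw [hA.eigenvectorBasis.repr_apply_apply, EuclideanSpace.inner_eq_star_dotProduct]
    simp [hc j]
  simpa using congrArg WithLp.ofLp this

/-- The property of `G` used throughout: the form `2 D(G) + I` is negative definite on the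
orthogonal complement of any vector on which it is positive. -/
def DistLorentzian {V : Type*} [Fintype V] (G : SimpleGraph V) : Prop :=
  ∀ x y : V → ℝ, 0 < distForm G x x → distForm G x y = 0 → 0 ≤ distForm G y y → y = 0

theorem distLorentzian_of_lambda2_lt {V : Type*} [Fintype V] [DecidableEq V] (G : SimpleGraph V)
    (hcard : 2 ≤ Fintype.card V) (hlam : lambda2 G < -1/2) : DistLorentzian G := by
  obtain ⟨i, hi⟩ := exists_forall_ne_eigenvalues_lt G hcard hlam
  intro x y hx hxy hy
  set φ : V → ℝ := ⇑((distMatrix_isHermitian G).eigenvectorBasis i)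
  have hz : (y ⬝ᵥ φ) • x + (-(x ⬝ᵥ φ)) • y = 0 := by
    refine eq_zero_of_distForm_nonneg hi ?_ ?_
    · change ((y ⬝ᵥ φ) • x + (-(x ⬝ᵥ φ)) • y) ⬝ᵥ φ = 0
      simp only [add_dotProduct, smul_dotProduct, smul_eq_mul]
      ring
    · rw [distForm_comb, distForm_comm G _ x, distForm_comm G _ y, distForm_comb, distForm_comb,
        distForm_comm G y x, hxy]
      nlinarith [mul_nonneg (sq_nonneg (y ⬝ᵥ φ)) hx.le, mul_nonneg (sq_nonneg (x ⬝ᵥ φ)) hy]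
  have h0 : y ⬝ᵥ φ = 0 := by
    have := distForm_comb G (y ⬝ᵥ φ) (-(x ⬝ᵥ φ)) x y x
    rw [hz, hxy] at this
    simp only [distForm, Matrix.mulVec_zero, dotProduct_zero] at this
    have h2 : (y ⬝ᵥ φ) * distForm G x x = 0 := by unfold distForm; linarith
    exact (mul_eq_zero.1 h2).resolve_right hx.ne'
  exact eq_zero_of_distForm_nonneg hi h0 hy

theorem distForm_sum_single {V : Type*} [Fintype V] [DecidableEq V] (G : SimpleGraph V) {k : ℕ}
    {f : Fin k → V} (hf : Function.Injective f) (x y : Fin k → ℝ) :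
    distForm G (∑ i, Pi.single (f i) (x i)) (∑ j, Pi.single (f j) (y j)) =
      ∑ i, ∑ j, x i * y j * (2 * G.dist (f i) (f j) + if i = j then 1 else 0) := by
  simp only [distForm, Matrix.mulVec_sum, dotProduct_sum, sum_dotProduct, Finset.mul_sum,
    ← Finset.sum_add_distrib]
  rw [Finset.sum_comm]
  refine Finset.sum_congr rfl fun i _ => Finset.sum_congr rfl fun j _ => ?_
  simp only [single_dotProduct, Matrix.mulVec_single, distMatrix,
    Pi.single_apply, hf.eq_iff]
  simp
  split_ifs <;> ring

theorem DistLorentzian.eq_zero {V : Type*} [Fintype V] [DecidableEq V] {G : SimpleGraph V}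
    (hG : DistLorentzian G) {k : ℕ} {f : Fin k → V} (hf : Function.Injective f) (x y : Fin k → ℝ)
    (hx : 0 < ∑ i, ∑ j, x i * x j * (2 * (G.dist (f i) (f j) : ℝ) + if i = j then 1 else 0))
    (hxy : ∑ i, ∑ j, x i * y j * (2 * (G.dist (f i) (f j) : ℝ) + if i = j then 1 else 0) = 0)
    (hy : 0 ≤ ∑ i, ∑ j, y i * y j * (2 * (G.dist (f i) (f j) : ℝ) + if i = j then 1 else 0)) :
    y = 0 := by
  have := hG (∑ i, Pi.single (f i) (x i)) (∑ j, Pi.single (f j) (y j))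
    (by rwa [distForm_sum_single G hf]) (by rwa [distForm_sum_single G hf])
    (by rwa [distForm_sum_single G hf])
  ext i
  have h := congrFun this (f i)
  simpa [Finset.sum_apply, Pi.single_apply, hf.eq_iff] using h

theorem dist_add_le_of_dist_eq {V : Type*} [Fintype V] [DecidableEq V] {G : SimpleGraph V}
    (hG : DistLorentzian G) {p q r s : V} (hpq : G.Adj p q) (hrs : G.Adj r s)
    (hpr : p ≠ r) (hps : p ≠ s) (hqr : q ≠ r) (hqs : q ≠ s) (h : G.dist p s = G.dist q r) :
    G.dist p s + G.dist q r ≤ G.dist p r + G.dist q s := by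
  by_contra! hlt
  have hlt' : (G.dist p r : ℝ) + G.dist q s + 1 ≤ G.dist p s + G.dist q r := by
    exact_mod_cast hlt
  have h' : (G.dist p s : ℝ) = G.dist q r := by exact_mod_cast h
  have hinj : Function.Injective ![p, q, r, s] := by
    intro i j hij
    fin_cases i <;> fin_cases j <;> simp_all [hpq.ne, hrs.ne, hpq.ne', hrs.ne', Ne.symm]
  have e1 : (G.dist p q : ℝ) = 1 := by exact_mod_cast dist_eq_one_iff_adj.2 hpq
  have e2 : (G.dist r s : ℝ) = 1 := by exact_mod_cast dist_eq_one_iff_adj.2 hrs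
  have := hG.eq_zero hinj ![1, 1, 1, 1] ![1, -1, -1, 1]
    (by simp [Fin.sum_univ_four]; positivity)
    (by simp [Fin.sum_univ_four, G.dist_comm (u := q) (v := p),
          G.dist_comm (u := r) (v := p), G.dist_comm (u := s) (v := p),
          G.dist_comm (u := r) (v := q), G.dist_comm (u := s) (v := q),
          G.dist_comm (u := s) (v := r)]; linarith)
    (by simp [Fin.sum_univ_four, G.dist_comm (u := q) (v := p),
          G.dist_comm (u := r) (v := p), G.dist_comm (u := s) (v := p),
          G.dist_comm (u := r) (v := q), G.dist_comm (u := s) (v := q),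
          G.dist_comm (u := s) (v := r)]; linarith)
  simpa using congrFun this 0

/-- Two adjacent vertices have at most two pairwise non-adjacent common neighbours. -/
theorem not_three_common_neighbors {V : Type*} [Fintype V] [DecidableEq V] {G : SimpleGraph V}
    (hG : DistLorentzian G) {a b c d e : V} (hab : G.Adj a b)
    (hca : G.Adj c a) (hcb : G.Adj c b) (hda : G.Adj d a) (hdb : G.Adj d b)
    (hea : G.Adj e a) (heb : G.Adj e b)
    (hcd : G.dist c d = 2) (hce : G.dist c e = 2) (hde : G.dist d e = 2) : False := by
  have hne : c ≠ d ∧ c ≠ e ∧ d ≠ e := by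
    refine ⟨?_, ?_, ?_⟩ <;> rintro rfl <;> simp_all
  obtain ⟨h1, h2, h3⟩ := hne
  have hinj : Function.Injective ![a, b, c, d, e] := by
    intro i j hij
    fin_cases i <;> fin_cases j <;> simp_all
  have := hG.eq_zero hinj ![1, 1, 0, 0, 0] ![-2, -2, 1, 1, 1]
    (by simp [Fin.sum_univ_five, dist_eq_one_iff_adj.2, hab, hab.symm]; norm_num)
    (by simp [Fin.sum_univ_five, dist_eq_one_iff_adj.2, G.adj_symm, *]; norm_num)
    (by simp [Fin.sum_univ_five, dist_eq_one_iff_adj.2, G.adj_symm,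
          G.dist_comm (u := e) (v := c), G.dist_comm (u := e) (v := d),
          G.dist_comm (u := d) (v := c), *]; norm_num)
  simpa using congrFun this 2

/-- A vertex of degree two in a diamond has no neighbour at distance three from the opposite
vertex and distance two from the other vertices of the diamond. -/
theorem not_pendant_diamond {V : Type*} [Fintype V] [DecidableEq V] {G : SimpleGraph V}
    (hG : DistLorentzian G) {a b w q c : V} (hab : G.Adj a b)
    (hwa : G.Adj w a) (hwb : G.Adj w b) (hqa : G.Adj q a) (hqb : G.Adj q b) (hcw : G.Adj c w)
    (hwq : G.dist w q = 2) (hca : G.dist c a = 2) (hcb : G.dist c b = 2)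
    (hcq : G.dist c q = 3) : False := by
  have hne : w ≠ q ∧ c ≠ a ∧ c ≠ b ∧ c ≠ q := by
    refine ⟨?_, ?_, ?_, ?_⟩ <;> rintro rfl <;> simp_all
  obtain ⟨h1, h2, h3, h4⟩ := hne
  have hinj : Function.Injective ![a, b, w, q, c] := by
    intro i j hij
    fin_cases i <;> fin_cases j <;> simp_all
  have := hG.eq_zero hinj ![0, 0, 0, 0, 1] ![-1, -1, 1, 1, 0]
    (by simp [Fin.sum_univ_five])
    (by simp [Fin.sum_univ_five, dist_eq_one_iff_adj.2, *]; norm_num)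
    (by simp [Fin.sum_univ_five, dist_eq_one_iff_adj.2, G.adj_symm,
          G.dist_comm (u := q) (v := w), *]; norm_num)
  simpa using congrFun this 2

theorem SimpleGraph.Connected.exists_adj_dist_eq {V : Type*} {G : SimpleGraph V}
    (hconn : G.Connected) {u v : V} {k : ℕ} (h : G.dist u v = k + 1) :
    ∃ w, G.Adj u w ∧ G.dist w v = k := by
  obtain ⟨p, hp⟩ := hconn.exists_walk_length_eq_dist u v
  cases p with
  | nil => simp at h
  | cons hadj q =>
    refine ⟨_, hadj, ?_⟩
    have h1 := dist_le q
    have h2 := hconn.dist_triangle (u := u) (v := _) (w := v) |>.trans_eq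
      (congrArg (· + _) (dist_eq_one_iff_adj.2 hadj))
    simp at hp
    omega

theorem SimpleGraph.Connected.dist_le_dist_add_one {V : Type*} {G : SimpleGraph V}
    (hconn : G.Connected) (u : V) {v w : V} (h : G.Adj v w) : G.dist u v ≤ G.dist u w + 1 := by
  have := hconn.dist_triangle (u := u) (v := w) (w := v)
  rwa [dist_eq_one_iff_adj.2 h.symm] at this

theorem SimpleGraph.Connected.dist_eq_two {V : Type*} {G : SimpleGraph V}
    (hconn : G.Connected) {u v w : V} (huw : G.Adj u w) (hwv : G.Adj w v) (hne : u ≠ v)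
    (hn : ¬ G.Adj u v) : G.dist u v = 2 := by
  have h1 := hconn.dist_le_dist_add_one u hwv.symm
  rw [dist_eq_one_iff_adj.2 huw] at h1
  have h2 := hconn.one_lt_dist_of_ne_of_not_adj hne hn
  omega

/-- The first `β + 1` terms of `r` form a geodesic. -/
def IsGeodesicSeq {V : Type*} (G : SimpleGraph V) (r : ℕ → V) (β : ℕ) : Prop :=
  ∀ i j, i ≤ j → j ≤ β → G.dist (r i) (r j) = j - i

theorem IsGeodesicSeq.adj {V : Type*} {G : SimpleGraph V} {r : ℕ → V}
    {β i : ℕ} (hr : IsGeodesicSeq G r β) (hi : i < β) :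
    G.Adj (r i) (r (i + 1)) := by
  rw [← dist_eq_one_iff_adj, hr i (i + 1) (by omega) hi]
  omega

theorem exists_isGeodesicSeq {V : Type*} {G : SimpleGraph V} (hconn : G.Connected) (w x : V) :
    ∃ r : ℕ → V, IsGeodesicSeq G r (G.dist w x) ∧ r 0 = w ∧ r (G.dist w x) = x := by
  induction hβ : G.dist w x generalizing w with
  | zero =>
    rw [hconn.dist_eq_zero_iff] at hβ
    refine ⟨fun _ => w, fun i j hi hj => ?_, rfl, hβ⟩
    simp
    omega
  | succ β ih =>
    obtain ⟨w', hw', hk⟩ := hconn.exists_adj_dist_eq hβ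
    obtain ⟨r, hr, h0, h1⟩ := ih w' hk
    refine ⟨fun n => Nat.casesOn n w r, ?_, rfl, h1⟩
    intro i j hij hj
    rcases i with _ | i
    · rcases j with _ | j
      · simp
      · have e1 := hr j β (by omega) le_rfl
        have e2 := hr 0 j (by omega) (by omega)
        have e3 := hconn.dist_triangle (u := w) (v := r j) (w := x)
        have e4 := hconn.dist_le_dist_add_one (r j) hw'
        rw [h1] at e1
        rw [h0] at e2
        rw [G.dist_comm (u := r j), G.dist_comm (u := r j)] at e4
        change G.dist w (r j) = j + 1 - 0
        omega
    · rcases j with _ | j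
      · omega
      · simp only
        rw [hr i j (by omega) (by omega)]
        omega

section Local

variable {V : Type*} [Fintype V] [DecidableEq V] {G : SimpleGraph V}

theorem adj_of_dist_eq (hconn : G.Connected) (hG : DistLorentzian G) {v x y z : V}
    (hxy : G.Adj x y) (hzx : G.Adj z x) (heq : G.dist v x = G.dist v y)
    (hz : G.dist v x = G.dist v z + 1) : G.Adj z y := by
  induction hk : G.dist v z generalizing v with
  | zero =>
    rw [hconn.dist_eq_zero_iff] at hk
    subst hk
    rw [← dist_eq_one_iff_adj, ← heq, hz, G.dist_self]
  | succ k ih =>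
    obtain ⟨v', hv', hk'⟩ := hconn.exists_adj_dist_eq hk
    have hx1 := hconn.dist_le_dist_add_one v' hzx.symm
    have hx2 := hconn.dist_le_dist_add_one x hv'
    have hy1 := hconn.dist_le_dist_add_one v' hxy.symm
    have hy2 := hconn.dist_le_dist_add_one y hv'
    rw [G.dist_comm (u := x), G.dist_comm (u := x)] at hx2
    rw [G.dist_comm (u := y), G.dist_comm (u := y)] at hy2
    have hy : G.dist v' y = k + 1 := by
      by_contra hne
      have hne1 : v ≠ y := by rintro rfl; have := G.dist_self (v := v); omega
      have hne2 : v ≠ x := by rintro rfl; simp at hz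
      have hne3 : v' ≠ y := by rintro rfl; simp at hy2; omega
      have hne4 : v' ≠ x := by rintro rfl; simp at hx2; omega
      have := dist_add_le_of_dist_eq hG hv' hxy.symm hne1 hne2 hne3 hne4 (by omega)
      omega
    exact ih (by omega) (by omega) hk'

/-- Balls are convex along induced paths of length two. -/
theorem not_dist_peak (hconn : G.Connected) (hG : DistLorentzian G) {u x y z : V}
    (hxy : G.Adj x y) (hyz : G.Adj y z) (hxz : G.dist x z = 2)
    (h1 : G.dist u y = G.dist u x + 1) (h2 : G.dist u y = G.dist u z + 1) : False := by
  induction hk : G.dist u x generalizing u with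
  | zero =>
    have h3 : G.dist u z = 0 := by omega
    rw [hconn.dist_eq_zero_iff] at hk h3
    subst hk h3
    simp at hxz
  | succ k ih =>
    obtain ⟨u', hu', hk'⟩ := hconn.exists_adj_dist_eq hk
    have hy1 := hconn.dist_le_dist_add_one u' hxy.symm
    have hy2 := hconn.dist_le_dist_add_one y hu'
    have hz2 := hconn.dist_le_dist_add_one z hu'
    have hz3 := hconn.dist_le_dist_add_one z hu'.symm
    rw [G.dist_comm (u := y), G.dist_comm (u := y)] at hy2
    rw [G.dist_comm (u := z), G.dist_comm (u := z)] at hz2 hz3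
    have hy : G.dist u' y = k + 1 := by omega
    by_cases hza : G.dist u' z = k
    · exact ih (by omega) (by omega) hk'
    by_cases hzb : G.dist u' z = k + 1
    · have := adj_of_dist_eq hconn hG hyz hxy (v := u') (by omega) (by omega)
      rw [dist_eq_one_iff_adj.2 this] at hxz
      omega
    have hne1 : u ≠ z := by rintro rfl; have := G.dist_self (v := u); omega
    have hne2 : u ≠ y := by rintro rfl; simp at h2
    have hne3 : u' ≠ z := by rintro rfl; have := G.dist_self (v := u'); omega
    have hne4 : u' ≠ y := by rintro rfl; simp at hy
    have := dist_add_le_of_dist_eq hG hu' hyz.symm hne1 hne2 hne3 hne4 (by omega)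
    omega

theorem not_gem (hconn : G.Connected) (hG : DistLorentzian G) {h a b c d : V}
    (hab : G.Adj a b) (hbc : G.Adj b c) (hcd : G.Adj c d) (hac : ¬ G.Adj a c) (hbd : ¬ G.Adj b d)
    (had : ¬ G.Adj a d) (nac : a ≠ c) (nbd : b ≠ d) (nad : a ≠ d)
    (ha : G.Adj h a) (hd : G.Adj h d) : False := by
  have h1 := hconn.dist_eq_two hab hbc nac hac
  have h2 := hconn.dist_eq_two hbc hcd nbd hbd
  have h3 := hconn.dist_eq_two ha.symm hd nad had
  have := dist_add_le_of_dist_eq hG hab hcd.symm nad nac nbd hbc.ne (by omega)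
  rw [dist_eq_one_iff_adj.2 hbc] at this
  omega

theorem not_cycle4 (hconn : G.Connected) (hG : DistLorentzian G) {a b c d : V}
    (hab : G.Adj a b) (hbc : G.Adj b c) (hcd : G.Adj c d) (hda : G.Adj d a) (hac : ¬ G.Adj a c)
    (nac : a ≠ c) (hbd : ¬ G.Adj b d) (nbd : b ≠ d) : False := by
  have h1 := hconn.dist_eq_two hab hbc nac hac
  have h2 := hconn.dist_eq_two hbc hcd nbd hbd
  have := dist_add_le_of_dist_eq hG hab hcd.symm hda.ne' nac nbd hbc.ne (by omega)
  rw [dist_eq_one_iff_adj.2 hbc, dist_eq_one_iff_adj.2 hda.symm] at this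
  omega

theorem dist_geodesic_shape (hconn : G.Connected) (hG : DistLorentzian G) (u : V) {β : ℕ}
    {r : ℕ → V} (hr : IsGeodesicSeq G r β) :
    ∃ m c n h : ℕ, m + c + n = β ∧ c ≤ 2 ∧ (∀ i ≤ m, G.dist u (r i) = h + (m - i)) ∧
      (∀ i, m ≤ i → i ≤ m + c → G.dist u (r i) = h) ∧
      (∀ i, m + c ≤ i → i ≤ β → G.dist u (r i) = h + (i - (m + c))) := by
  induction β generalizing r with
  | zero =>
    refine ⟨0, 0, 0, G.dist u (r 0), rfl, by omega, ?_, ?_, ?_⟩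
    · intro i hi
      obtain rfl : i = 0 := by omega
      rfl
    · intro i _ hi
      obtain rfl : i = 0 := by omega
      rfl
    · intro i _ hi
      obtain rfl : i = 0 := by omega
      rfl
  | succ β ih =>
    have hr' : IsGeodesicSeq G (fun i => r (i + 1)) β := by
      intro i j hij hj
      rw [hr (i + 1) (j + 1) (by omega) (by omega)]
      omega
    obtain ⟨m, c, n, h, hsum, hc, hm, hflat, hn⟩ := ih hr'
    have hadj := hr.adj (i := 0) (by omega)
    have hs1 := hconn.dist_le_dist_add_one u hadj
    have hs2 := hconn.dist_le_dist_add_one u hadj.symm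
    simp only [zero_add] at hadj hs1 hs2
    have hm0 := hm 0 (by omega)
    simp only [zero_add] at hm0
    rcases (show G.dist u (r 0) = G.dist u (r 1) + 1 ∨ G.dist u (r 0) = G.dist u (r 1) ∨
      G.dist u (r 1) = G.dist u (r 0) + 1 by omega) with h0 | h0 | h0
    · refine ⟨m + 1, c, n, h, by omega, hc, ?_, ?_, ?_⟩
      · intro i hi
        rcases i with _ | i
        · omega
        · have := hm i (by omega)
          omega
      · intro i hi hi'
        rcases i with _ | i
        · omega
        · exact hflat i (by omega) (by omega)
      · intro i hi hi'
        rcases i with _ | i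
        · omega
        · have := hn i (by omega) (by omega)
          omega
    · have hm' : m = 0 := by
        by_contra hne
        have h1 := hm 1 (by omega)
        have ha := hr.adj (i := 1) (by omega)
        have hd := hr 0 2 (by omega) (by omega)
        have := adj_of_dist_eq hconn hG hadj.symm ha.symm h0.symm
          (by simp only [Nat.reduceAdd] at *; omega)
        rw [← dist_eq_one_iff_adj, G.dist_comm, hd] at this
        omega
      subst hm'
      have hc' : c ≤ 1 := by
        by_contra hne
        have h1 := hflat 1 (by omega) (by omega)
        have h2 := hflat 2 (by omega) (by omega)
        simp only [Nat.reduceAdd] at h1 h2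
        have a1 := hr.adj (i := 1) (by omega)
        have a2 := hr.adj (i := 2) (by omega)
        simp only [Nat.reduceAdd] at a1 a2
        have hpos : G.dist u (r 0) ≠ 0 := by
          intro hz
          have hz1 : G.dist u (r 1) = 0 := by omega
          rw [hconn.dist_eq_zero_iff] at hz hz1
          rw [← hz, ← hz1] at hadj
          exact hadj.ne rfl
        obtain ⟨k, hk⟩ := Nat.exists_eq_succ_of_ne_zero hpos
        obtain ⟨z, hz, hzk⟩ := hconn.exists_adj_dist_eq (u := r 0) (v := u) (k := k)
          (by rw [G.dist_comm]; omega)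
        rw [G.dist_comm] at hzk
        have b1 := adj_of_dist_eq hconn hG hadj hz.symm (v := u) (by omega) (by omega)
        have b2 := adj_of_dist_eq hconn hG a1 b1 (v := u) (by omega) (by omega)
        have b3 := adj_of_dist_eq hconn hG a2 b2 (v := u) (by omega) (by omega)
        have hd := hr 0 3 (by omega) (by omega)
        have := hconn.dist_le_dist_add_one (r 0) b3.symm
        rw [dist_eq_one_iff_adj.2 hz] at this
        omega
      refine ⟨0, c + 1, n, h, by omega, by omega, ?_, ?_, ?_⟩
      · intro i hi
        obtain rfl : i = 0 := by omega
        omega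
      · intro i hi hi'
        rcases i with _ | i
        · omega
        · exact hflat i (by omega) (by omega)
      · intro i hi hi'
        rcases i with _ | i
        · omega
        · have := hn i (by omega) (by omega)
          omega
    · have hmc : m = 0 ∧ c = 0 := by
        by_contra hne
        have ha := hr.adj (i := 1) (by omega)
        have hd := hr 0 2 (by omega) (by omega)
        simp only [Nat.reduceAdd] at ha
        rcases Nat.eq_zero_or_pos m with hm' | hm'
        · have h1 := hflat 1 (by omega) (by omega)
          simp only [Nat.reduceAdd] at h1
          have := adj_of_dist_eq hconn hG ha hadj (v := u) (by omega) (by omega)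
          rw [← dist_eq_one_iff_adj, hd] at this
          omega
        · have h1 := hm 1 (by omega)
          simp only [Nat.reduceAdd] at h1
          exact not_dist_peak hconn hG hadj ha (by omega) h0 (by omega)
      obtain ⟨rfl, rfl⟩ := hmc
      refine ⟨0, 0, n + 1, G.dist u (r 0), by omega, by omega, ?_, ?_, ?_⟩
      · intro i hi
        obtain rfl : i = 0 := by omega
        omega
      · intro i hi hi'
        obtain rfl : i = 0 := by omega
        omega
      · intro i hi hi'
        rcases i with _ | i
        · omega
        · have := hn i (by omega) (by omega)
          omega

end Local

theorem mul_le_mul_add_mul_of_add_le {a b c e f g : ℤ} (hc : 0 ≤ c) (he : 0 ≤ e)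
    (hf : 0 ≤ f) (hg : 0 ≤ g) (h5 : c ≤ a + g) (h6 : c ≤ b + f) (h7 : e ≤ a + f) (h8 : e ≤ b + g)
    (h : a + b ≤ c + e) (ha : 0 ≤ a) (hb : 0 ≤ b) : a * b ≤ c * e + f * g := by
  by_cases hca : a < c ∧ b < c
  · nlinarith [mul_le_mul (show c - b ≤ f by linarith) (show c - a ≤ g by linarith)
      (by linarith) hf, mul_nonneg hc (sub_nonneg.2 h)]
  by_cases hea : a < e ∧ b < e
  · nlinarith [mul_le_mul (show e - a ≤ f by linarith) (show e - b ≤ g by linarith)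
      (by linarith) hf, mul_nonneg he (sub_nonneg.2 h)]
  have hfg := mul_nonneg hf hg
  rcases le_total a b with hab | hab
  · nlinarith [mul_nonneg (show 0 ≤ b - c by omega) (show 0 ≤ b - e by omega),
      mul_nonneg hb (sub_nonneg.2 h)]
  · nlinarith [mul_nonneg (show 0 ≤ a - c by omega) (show 0 ≤ a - e by omega),
      mul_nonneg ha (sub_nonneg.2 h)]

/-- Ptolemy's inequality for an integral metric on four points `u, v, w, x`, where
`a = uv`, `b = wx`, `c = uw`, `e = vx`, `f = ux`, `g = vw`. -/
theorem mul_le_mul_add_mul_of_four_point {a b c e f g : ℤ} (ha : 0 ≤ a) (hb : 0 ≤ b) (hc : 0 ≤ c)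
    (he : 0 ≤ e) (hf : 0 ≤ f) (hg : 0 ≤ g)
    (h1 : a ≤ c + g) (h2 : a ≤ f + e) (h3 : b ≤ c + f) (h4 : b ≤ g + e)
    (h5 : c ≤ a + g) (h6 : c ≤ b + f) (h7 : e ≤ a + f) (h8 : e ≤ b + g)
    (h9 : f ≤ a + e) (h10 : f ≤ b + c) (h11 : g ≤ a + c) (h12 : g ≤ b + e)
    (hfour : c + e < a + b → f + g < a + b → a + b = c + e + 1 ∧ a + b = f + g + 1) :
    a * b ≤ c * e + f * g := by
  by_cases hce : a + b ≤ c + e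
  · exact mul_le_mul_add_mul_of_add_le hc he hf hg h5 h6 h7 h8 hce ha hb
  by_cases hfg : a + b ≤ f + g
  · rw [add_comm (c * e)]
    exact mul_le_mul_add_mul_of_add_le hf hg hc he h9 h10 h11 h12 hfg ha hb
  obtain ⟨k1, k2⟩ := hfour (by omega) (by omega)
  have hU : 0 ≤ c + f - b := by omega
  have hV : 0 ≤ e + g - b := by omega
  have hW : 0 ≤ c + g - a := by omega
  have hX : 0 ≤ f + e - a := by omega
  obtain rfl : b = c + e + 1 - a := by omega
  obtain rfl : g = c + e - f := by omega
  rcases (show (1 ≤ c + f - (c + e + 1 - a) ∧ 1 ≤ e + (c + e - f) - (c + e + 1 - a)) ∨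
    (1 ≤ c + (c + e - f) - a ∧ 1 ≤ f + e - a) by omega) with ⟨p, q⟩ | ⟨p, q⟩
  · nlinarith [mul_nonneg (sub_nonneg.2 p) (sub_nonneg.2 q), mul_nonneg hW hX]
  · nlinarith [mul_nonneg (sub_nonneg.2 p) (sub_nonneg.2 q), mul_nonneg hU hV]

section FourPoint

variable {V : Type*} [Fintype V] [DecidableEq V] {G : SimpleGraph V}

theorem exists_adj_of_flat (hconn : G.Connected) (hG : DistLorentzian G) {u : V} {β m c h : ℕ}
    {r : ℕ → V} (hr : IsGeodesicSeq G r β) (hc : 1 ≤ c) (hmc : m + c ≤ β)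
    (hflat : ∀ i, m ≤ i → i ≤ m + c → G.dist u (r i) = h) :
    ∃ z, G.dist u z + 1 = h ∧ ∀ i ≤ c, G.Adj z (r (m + i)) := by
  have h0 := hflat m le_rfl (by omega)
  have h1 := hflat (m + 1) (by omega) (by omega)
  have hadj := hr.adj (i := m) (by omega)
  have hpos : h ≠ 0 := by
    rintro rfl
    rw [hconn.dist_eq_zero_iff] at h0 h1
    rw [← h0, ← h1] at hadj
    exact hadj.ne rfl
  obtain ⟨k, rfl⟩ := Nat.exists_eq_succ_of_ne_zero hpos
  obtain ⟨z, hz, hzk⟩ := hconn.exists_adj_dist_eq (u := r m) (v := u) (k := k)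
    (by rw [G.dist_comm, h0])
  rw [G.dist_comm] at hzk
  refine ⟨z, by omega, fun i => ?_⟩
  induction i with
  | zero => exact fun _ => hz.symm
  | succ i ih =>
    intro hi
    have e1 := hflat (m + i) (by omega) (by omega)
    have e2 := hflat (m + (i + 1)) (by omega) (by omega)
    exact adj_of_dist_eq hconn hG (hr.adj (i := m + i) (by omega)) (ih (by omega)) (v := u)
      (by rw [e1, ← e2]) (by omega)

/-- If the sum of one pair of opposite distances strictly exceeds the two other such sums, then it
exceeds each of them by exactly one. -/
theorem dist_four_point (hconn : G.Connected) (hG : DistLorentzian G) (u v w x : V)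
    (h2 : G.dist u w + G.dist v x < G.dist u v + G.dist w x)
    (h3 : G.dist u x + G.dist v w < G.dist u v + G.dist w x) :
    G.dist u v + G.dist w x = G.dist u w + G.dist v x + 1 ∧
      G.dist u v + G.dist w x = G.dist u x + G.dist v w + 1 := by
  obtain ⟨r, hr, hr0, hrβ⟩ := exists_isGeodesicSeq hconn w x
  obtain ⟨m, c, n, h, hs, hc, hm, hflat, hn⟩ := dist_geodesic_shape hconn hG u hr
  obtain ⟨m', c', n', h', hs', hc', hm', hflat', hn'⟩ := dist_geodesic_shape hconn hG v hr
  wlog hle : m ≤ m' generalizing u v m c n h m' c' n' h'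
  · have := this v u (by rw [G.dist_comm (u := v) (v := u)]; omega)
      (by rw [G.dist_comm (u := v) (v := u)]; omega) m' c' n' h' hs' hc' hm' hflat' hn'
      m c n h hs hc hm hflat hn (by omega)
    rw [G.dist_comm (u := v) (v := u)] at this
    omega
  have euw := hm 0 (by omega)
  have eux := hn (G.dist w x) (by omega) le_rfl
  have evw := hm' 0 (by omega)
  have evx := hn' (G.dist w x) (by omega) le_rfl
  rw [hr0] at euw evw
  rw [hrβ] at eux evx
  have em' := hflat' m' le_rfl (by omega)
  have hgap : m' < m + c := by
    by_contra hge
    have t1 := hconn.dist_triangle (u := u) (v := r (m + c)) (w := v)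
    have t2 := hconn.dist_triangle (u := r (m + c)) (v := r m') (w := v)
    rw [hr (m + c) m' (by omega) (by omega), G.dist_comm (u := r m') (v := v), em'] at t2
    rw [hflat (m + c) (by omega) le_rfl] at t1
    omega
  have hb : G.dist u v ≤ h + h' := by
    have t1 := hconn.dist_triangle (u := u) (v := r m') (w := v)
    rwa [hflat m' hle hgap.le, G.dist_comm (u := r m') (v := v), em'] at t1
  rcases Nat.eq_zero_or_pos c' with h0 | hc1
  · omega
  by_cases hone : m' = m ∧ c = 1 ∧ c' = 1
  · omega
  suffices G.dist u v + 1 ≤ h + h' by omega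
  obtain ⟨z, hz, hza⟩ := exists_adj_of_flat hconn hG hr (by omega) (by omega) hflat
  obtain ⟨z', hz', hza'⟩ := exists_adj_of_flat hconn hG hr hc1 (by omega) hflat'
  suffices hzz : G.Adj z z' ∨ z = z' by
    have t1 := hconn.dist_triangle (u := u) (v := z') (w := v)
    rw [G.dist_comm (u := z') (v := v)] at t1
    rcases hzz with hzz | rfl
    · have := hconn.dist_le_dist_add_one u hzz.symm
      omega
    · omega
  by_contra! hcon
  obtain ⟨nadj, nne⟩ := hcon
  have nadj' : ¬ G.Adj z' z := fun e => nadj e.symm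
  have hnr : ∀ i, m ≤ i → i + 2 ≤ G.dist w x → ¬ G.Adj (r i) (r (i + 2)) ∧ r i ≠ r (i + 2) := by
    intro i _ hi
    have := hr i (i + 2) (by omega) hi
    constructor
    · intro e
      rw [dist_eq_one_iff_adj.2 e] at this
      omega
    · intro e
      rw [← e, G.dist_self] at this
      omega
  have hzn : ∀ i, G.dist u (r i) = h + 1 → ¬ G.Adj z (r i) ∧ z ≠ r i := by
    intro i hi
    constructor
    · intro e
      have := hconn.dist_le_dist_add_one u e.symm
      omega
    · rintro rfl
      omega
  have hzn' : ∀ i, G.dist v (r i) = h' + 1 → ¬ G.Adj z' (r i) ∧ z' ≠ r i := by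
    intro i hi
    constructor
    · intro e
      have := hconn.dist_le_dist_add_one v e.symm
      omega
    · rintro rfl
      omega
  rcases (show (m' = m ∧ c = 2 ∧ c' = 2) ∨ (m' = m ∧ c = 2 ∧ c' = 1) ∨
      (m' = m + 1 ∧ c = 2 ∧ c' = 1) ∨ (m' = m ∧ c = 1 ∧ c' = 2) ∨ (m' = m + 1 ∧ c = 2 ∧ c' = 2)
      by omega) with
    ⟨rfl, rfl, rfl⟩ | ⟨rfl, rfl, rfl⟩ | ⟨rfl, rfl, rfl⟩ | ⟨rfl, rfl, rfl⟩ | ⟨rfl, rfl, rfl⟩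
  · obtain ⟨n1, n2⟩ := hnr m' le_rfl (by omega)
    exact not_cycle4 hconn hG (hza 0 (by omega)) (hza' 0 (by omega)).symm (hza' 2 le_rfl)
      (hza 2 le_rfl).symm nadj nne n1 n2
  · obtain ⟨n1, n2⟩ := hnr m' le_rfl (by omega)
    obtain ⟨n3, n4⟩ := hzn' (m' + 2) (by rw [hn' (m' + 2) (by omega) (by omega)]; omega)
    exact not_gem hconn hG (hza' 0 (by omega)) (hza 0 (by omega)).symm (hza 2 le_rfl)
      nadj' n1 n3 nne.symm n2 n4 (hza' 1 (by omega)).symm (hr.adj (i := m' + 1) (by omega))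
  · obtain ⟨n1, n2⟩ := hnr m le_rfl (by omega)
    obtain ⟨n3, n4⟩ := hzn' m (by rw [hm' m (by omega)]; omega)
    exact not_gem hconn hG (hza' 1 (by omega)) (hza 2 (by omega)).symm (hza 0 (by omega))
      nadj' (fun e => n1 e.symm) n3 nne.symm n2.symm n4 (hza' 0 (by omega)).symm
      (hr.adj (i := m) (by omega)).symm
  · obtain ⟨n1, n2⟩ := hnr m' le_rfl (by omega)
    obtain ⟨n3, n4⟩ := hzn (m' + 2) (by rw [hn (m' + 2) (by omega) (by omega)]; omega)
    exact not_gem hconn hG (hza 0 (by omega)) (hza' 0 (by omega)).symm (hza' 2 le_rfl)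
      nadj n1 n3 nne n2 n4 (hza 1 (by omega)).symm (hr.adj (i := m' + 1) (by omega))
  · obtain ⟨n1, n2⟩ := hnr m le_rfl (by omega)
    obtain ⟨n3, n4⟩ := hzn' m (by rw [hm' m (by omega)]; omega)
    exact not_gem hconn hG (hza 0 (by omega)).symm (hza 2 (by omega)) (hza' 1 (by omega)).symm
      n1 nadj (fun e => n3 e.symm) n2 nne n4.symm (hr.adj (i := m) (by omega)).symm
      (hza' 0 (by omega)).symm

theorem isPtolemaic_of_distLorentzian (hconn : G.Connected) (hG : DistLorentzian G) :
    IsPtolemaic G := by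
  intro u v w x
  have tri : ∀ p q s : V, (G.dist p q : ℤ) ≤ G.dist p s + G.dist s q := fun p q s => by
    exact_mod_cast hconn.dist_triangle
  have comm : ∀ p q : V, (G.dist p q : ℤ) = G.dist q p := fun p q => by rw [G.dist_comm]
  have hfour := dist_four_point hconn hG u v w x
  zify at hfour ⊢
  refine mul_le_mul_add_mul_of_four_point (by positivity) (by positivity) (by positivity)
    (by positivity) (by positivity) (by positivity) ?_ ?_ ?_ ?_ ?_ ?_ ?_ ?_ ?_ ?_ ?_ ?_ hfour
  · linarith [tri u v w, comm v w]
  · linarith [tri u v x, comm v x]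
  · linarith [tri w x u, comm u w]
  · linarith [tri w x v, comm v w]
  · linarith [tri u w v]
  · linarith [tri u w x, comm w x]
  · linarith [tri v x u, comm v u]
  · linarith [tri v x w]
  · linarith [tri u x v]
  · linarith [tri u x w]
  · linarith [tri v w u, comm v u]
  · linarith [tri v w x, comm w x]

end FourPoint

/-- `C` is a full component of `G - {a, b}`, as a predicate on vertices. -/
structure IsFullSide {V : Type*} (G : SimpleGraph V) (a b : V) (C : V → Prop) : Prop where
  not_left : ¬ C a
  not_right : ¬ C b
  closed : ∀ {y z}, C y → G.Adj y z → z ≠ a → z ≠ b → C z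
  exists_walk : ∀ {y z}, C y → C z → ∃ p : G.Walk y z, ∀ t ∈ p.support, C t
  exists_adj_left : ∃ y, C y ∧ G.Adj y a
  exists_adj_right : ∃ y, C y ∧ G.Adj y b

section Separator

variable {V : Type*} {G : SimpleGraph V} {a b : V} {C C' : V → Prop}

theorem exists_walk_avoiding_adj {S : Set V} {u t : V} (p : G.Walk u t) (hu : u ∉ S)
    (ht : t ∈ S) : ∃ s ∈ S, s ∈ p.support ∧ ∃ y, G.Adj y s ∧
      ∃ q : G.Walk u y, ∀ x ∈ q.support, x ∉ S := by
  induction p with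
  | nil => exact absurd ht hu
  | @cons u u' t hadj p ih =>
    by_cases hu' : u' ∈ S
    · exact ⟨u', hu', by simp, u, hadj, .nil, by simpa using hu⟩
    · obtain ⟨s, hs, hsp, y, hy, q, hq⟩ := ih hu' ht
      refine ⟨s, hs, by simp [hsp], y, hy, .cons hadj q, ?_⟩
      intro x hx
      rw [Walk.support_cons, List.mem_cons] at hx
      rcases hx with rfl | hx
      · exact hu
      · exact hq x hx

theorem isFullSide_of_walks [DecidableEq V] {u v : V} (hua : u ≠ a) (hub : u ≠ b)
    (ha : ∃ p : G.Walk u v, a ∈ p.support ∧ b ∉ p.support)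
    (hb : ∃ p : G.Walk u v, b ∈ p.support ∧ a ∉ p.support) :
    IsFullSide G a b (fun y => ∃ p : G.Walk u y, ∀ x ∈ p.support, x ∉ ({a, b} : Set V)) := by
  have hu : u ∉ ({a, b} : Set V) := by simp [hua, hub]
  refine ⟨?_, ?_, ?_, ?_, ?_, ?_⟩
  · rintro ⟨p, hp⟩
    exact hp a p.end_mem_support (by simp)
  · rintro ⟨p, hp⟩
    exact hp b p.end_mem_support (by simp)
  · rintro y z ⟨p, hp⟩ hyz hza hzb
    refine ⟨p.concat hyz, ?_⟩
    intro x hx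
    rw [Walk.support_concat, List.mem_append, List.mem_singleton] at hx
    rcases hx with hx | rfl
    · exact hp x hx
    · simp [hza, hzb]
  · rintro y z ⟨p, hp⟩ ⟨q, hq⟩
    refine ⟨p.reverse.append q, fun t ht => ?_⟩
    rw [Walk.mem_support_append_iff, Walk.support_reverse, List.mem_reverse] at ht
    rcases ht with ht | ht
    · exact ⟨p.takeUntil t ht, fun x hx => hp x (p.support_takeUntil_subset_support ht hx)⟩
    · exact ⟨q.takeUntil t ht, fun x hx => hq x (q.support_takeUntil_subset_support ht hx)⟩
  · obtain ⟨p, hap, hbp⟩ := ha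
    obtain ⟨s, hs, hsp, y, hy, q⟩ := exists_walk_avoiding_adj (p.takeUntil a hap) hu
      (by simp : a ∈ ({a, b} : Set V))
    have hsb : s ≠ b := by
      rintro rfl
      exact hbp (p.support_takeUntil_subset_support hap hsp)
    obtain rfl : s = a := by simpa [hsb] using hs
    exact ⟨y, q, hy⟩
  · obtain ⟨p, hbp, hap⟩ := hb
    obtain ⟨s, hs, hsp, y, hy, q⟩ := exists_walk_avoiding_adj (p.takeUntil b hbp) hu
      (by simp : b ∈ ({a, b} : Set V))
    have hsb : s ≠ a := by
      rintro rfl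
      exact hap (p.support_takeUntil_subset_support hbp hsp)
    obtain rfl : s = b := by simpa [hsb] using hs
    exact ⟨y, q, hy⟩

theorem exists_isFullSide_of_isMinimalVertexSeparator [DecidableEq V] {S : Finset V}
    (hcard : S.card = 2) (hS : IsMinimalVertexSeparator G S) :
    ∃ a b, a ≠ b ∧ S = {a, b} ∧ ∃ C C' : V → Prop, IsFullSide G a b C ∧ IsFullSide G a b C' ∧
      ∀ y, C y → ¬ C' y := by
  obtain ⟨a, b, hab, rfl⟩ := Finset.card_eq_two.1 hcard
  obtain ⟨u, v, -, -, ⟨hu, hv, hsep⟩, hmin⟩ := hS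
  have key : ∀ c ∈ ({a, b} : Finset V), ∃ p : G.Walk u v, ∀ x ∈ p.support,
      x ∈ ({a, b} : Finset V) → x = c := by
    intro c hc
    have := hmin _ (Finset.erase_ssubset hc)
    simp only [IsUVSeparator, not_and, not_forall, not_exists] at this
    obtain ⟨p, hp⟩ := this (fun h => hu (Finset.mem_of_mem_erase h))
      (fun h => hv (Finset.mem_of_mem_erase h))
    refine ⟨p, fun x hx hxS => ?_⟩
    by_contra hxc
    exact hp x hx (Finset.mem_erase.2 ⟨hxc, hxS⟩)
  have ha : ∃ p : G.Walk u v, a ∈ p.support ∧ b ∉ p.support := by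
    obtain ⟨p, hp⟩ := key a (by simp)
    obtain ⟨x, hx, hxS⟩ := hsep p
    exact ⟨p, hp x hx hxS ▸ hx, fun h => hab (hp b h (by simp)).symm⟩
  have hb : ∃ p : G.Walk u v, b ∈ p.support ∧ a ∉ p.support := by
    obtain ⟨p, hp⟩ := key b (by simp)
    obtain ⟨x, hx, hxS⟩ := hsep p
    exact ⟨p, hp x hx hxS ▸ hx, fun h => hab (hp a h (by simp))⟩
  simp only [Finset.mem_insert, Finset.mem_singleton, not_or] at hu hv
  refine ⟨a, b, hab, rfl, _, _, isFullSide_of_walks hu.1 hu.2 ha hb,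
    isFullSide_of_walks (v := u) hv.1 hv.2 ?_ ?_, ?_⟩
  · obtain ⟨p, hp⟩ := ha
    exact ⟨p.reverse, by simpa using hp⟩
  · obtain ⟨p, hp⟩ := hb
    exact ⟨p.reverse, by simpa using hp⟩
  · rintro y ⟨p, hp⟩ ⟨q, hq⟩
    obtain ⟨x, hx, hxS⟩ := hsep (p.append q.reverse)
    rw [Walk.mem_support_append_iff, Walk.support_reverse, List.mem_reverse] at hx
    rcases hx with hx | hx
    · exact hp x hx (by simpa using hxS)
    · exact hq x hx (by simpa using hxS)

theorem IsFullSide.dist_add_dist_le (hconn : G.Connected) (hC : IsFullSide G a b C) {y z : V}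
    (hy : C y) (hz : ¬ C z) :
    G.dist y a + G.dist a z ≤ G.dist y z ∨ G.dist y b + G.dist b z ≤ G.dist y z := by
  induction hk : G.dist y z generalizing y with
  | zero =>
    rw [hconn.dist_eq_zero_iff] at hk
    exact absurd (hk ▸ hy) hz
  | succ k ih =>
    obtain ⟨y', hyy', hk'⟩ := hconn.exists_adj_dist_eq hk
    have hle : ∀ t, G.dist y t ≤ G.dist y' t + 1 := fun t => by
      rw [G.dist_comm (v := t), G.dist_comm (v := t)]
      exact hconn.dist_le_dist_add_one t hyy'
    by_cases hya : y' = a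
    · left
      rw [← hya, dist_eq_one_iff_adj.2 hyy', hk', add_comm]
    by_cases hyb : y' = b
    · right
      rw [← hyb, dist_eq_one_iff_adj.2 hyy', hk', add_comm]
    have h1 := hle a
    have h2 := hle b
    rcases ih (hC.closed hy hyy' hya hyb) hk' with h | h <;> omega

theorem exists_dist_eq_or_jump_of_walk (hconn : G.Connected) {y z : V} (p : G.Walk y z)
    (hp : ∀ t ∈ p.support, C t) (hy : G.dist y a ≤ G.dist y b) (hz : G.dist z b ≤ G.dist z a) :
    (∃ s, C s ∧ G.dist s a = G.dist s b) ∨ ∃ s s', C s ∧ C s' ∧ G.Adj s s' ∧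
      G.dist s b = G.dist s a + 1 ∧ G.dist s' a = G.dist s a + 1 ∧ G.dist s' b = G.dist s a := by
  induction p with
  | @nil y => exact .inl ⟨y, hp y (by simp), le_antisymm hy hz⟩
  | @cons y y' z hadj p ih =>
    by_cases heq : G.dist y a = G.dist y b
    · exact .inl ⟨y, hp y (by simp), heq⟩
    by_cases hle : G.dist y' a ≤ G.dist y' b
    · exact ih (fun t ht => hp t (by simp [ht])) hle hz
    · have h1 := hconn.dist_le_dist_add_one a hadj.symm
      have h2 := hconn.dist_le_dist_add_one b hadj
      simp only [G.dist_comm (u := a), G.dist_comm (u := b)] at h1 h2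
      exact .inr ⟨y, y', hp y (by simp), hp y' (by simp), hadj, by omega, by omega, by omega⟩

theorem IsFullSide.exists_dist_eq_or_jump (hconn : G.Connected) (hC : IsFullSide G a b C) :
    (∃ s, C s ∧ G.dist s a = G.dist s b) ∨ ∃ s s', C s ∧ C s' ∧ G.Adj s s' ∧
      G.dist s b = G.dist s a + 1 ∧ G.dist s' a = G.dist s a + 1 ∧ G.dist s' b = G.dist s a := by
  obtain ⟨y, hy, hya⟩ := hC.exists_adj_left
  obtain ⟨z, hz, hzb⟩ := hC.exists_adj_right
  obtain ⟨p, hp⟩ := hC.exists_walk hy hz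
  refine exists_dist_eq_or_jump_of_walk hconn p hp ?_ ?_
  · rw [dist_eq_one_iff_adj.2 hya]
    exact hconn.pos_dist_of_ne fun h => hC.not_right (h ▸ hy)
  · rw [dist_eq_one_iff_adj.2 hzb]
    exact hconn.pos_dist_of_ne fun h => hC.not_left (h ▸ hz)

theorem hasInducedSubgraph_diamond {p q : V} (hab : G.Adj a b) (hpa : G.Adj p a)
    (hpb : G.Adj p b) (hqa : G.Adj q a) (hqb : G.Adj q b) (hpq : ¬ G.Adj p q) (hne : p ≠ q) :
    HasInducedSubgraph G diamondGraph := by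
  have hinj : Function.Injective ![a, b, p, q] := by
    intro i j hij
    fin_cases i <;> fin_cases j <;> simp_all
  have hqp : ¬ G.Adj q p := fun h => hpq h.symm
  refine ⟨Set.range ![a, b, p, q], ⟨RelIso.symm ⟨Equiv.ofInjective _ hinj, ?_⟩⟩⟩
  intro i j
  fin_cases i <;> fin_cases j <;> simp [diamondGraph, G.adj_symm, *]

variable [Fintype V] [DecidableEq V]

theorem IsFullSide.exists_dist_eq_of_dist_eq (hconn : G.Connected) (hG : DistLorentzian G)
    (hC : IsFullSide G a b C) (hdisj : ∀ y, C y → ¬ C' y) {s : V} (hs : C' s)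
    (heq : G.dist s a = G.dist s b) : ∃ y, C y ∧ G.dist y a = G.dist y b := by
  refine (hC.exists_dist_eq_or_jump hconn).resolve_right ?_
  rintro ⟨y, y', hy, hy', hadj, h1, h2, h3⟩
  have hsC : ¬ C s := fun h => hdisj s h hs
  have e1 := hC.dist_add_dist_le hconn hy hsC
  have e2 := hC.dist_add_dist_le hconn hy' hsC
  have t1 := hconn.dist_triangle (u := y) (v := a) (w := s)
  have t2 := hconn.dist_triangle (u := y') (v := b) (w := s)
  have hpos := hconn.pos_dist_of_ne (u := y) (v := a) fun h => hC.not_left (h ▸ hy)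
  obtain ⟨z, hyz, hz⟩ := hconn.exists_adj_dist_eq (u := y) (v := a) (k := G.dist y a - 1)
    (by omega)
  have t3 := hconn.dist_triangle (u := s) (v := a) (w := z)
  have t4 := hconn.dist_le_dist_add_one s hyz
  simp only [G.dist_comm (u := a), G.dist_comm (u := b), G.dist_comm (v := s)] at e1 e2 t1 t2
  rw [G.dist_comm (u := a)] at t3
  have hzy' := adj_of_dist_eq hconn hG hadj hyz.symm (v := s) (by omega) (by omega)
  have t5 := hconn.dist_le_dist_add_one a hzy'.symm
  rw [G.dist_comm, G.dist_comm (u := a)] at t5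
  omega

theorem IsFullSide.exists_dist_eq (hconn : G.Connected) (hG : DistLorentzian G)
    (hC : IsFullSide G a b C) (hC' : IsFullSide G a b C') (hdisj : ∀ y, C y → ¬ C' y) :
    ∃ y, C y ∧ G.dist y a = G.dist y b := by
  rcases hC'.exists_dist_eq_or_jump hconn with ⟨s, hs, heq⟩ | ⟨s, s', hs, hs', hss, k1, k2, k3⟩
  · exact hC.exists_dist_eq_of_dist_eq hconn hG hdisj hs heq
  refine (hC.exists_dist_eq_or_jump hconn).resolve_right ?_
  rintro ⟨y, y', hy, hy', hadj, h1, h2, h3⟩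
  have hne : ∀ p q, C p → C' q → p ≠ q := by
    rintro p q hp hq rfl
    exact hdisj p hp hq
  have e1 := hC.dist_add_dist_le hconn hy (z := s') (fun h => hdisj _ h hs')
  have e2 := hC.dist_add_dist_le hconn hy' (z := s) (fun h => hdisj _ h hs)
  have t1 := hconn.dist_triangle (u := y) (v := a) (w := s)
  have t2 := hconn.dist_triangle (u := y') (v := b) (w := s')
  have t3 := hconn.dist_triangle (u := y) (v := a) (w := s')
  have t4 := hconn.dist_triangle (u := y') (v := b) (w := s)
  simp only [G.dist_comm (u := a), G.dist_comm (u := b)] at e1 e2 t1 t2 t3 t4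
  have := dist_add_le_of_dist_eq hG hadj hss (hne _ _ hy hs) (hne _ _ hy hs') (hne _ _ hy' hs)
    (hne _ _ hy' hs') (by omega)
  omega

theorem IsFullSide.adj (hconn : G.Connected) (hG : DistLorentzian G) (hab : a ≠ b)
    (hC : IsFullSide G a b C) (hC' : IsFullSide G a b C') (hdisj : ∀ y, C y → ¬ C' y) :
    G.Adj a b := by
  obtain ⟨y, hy, hyeq⟩ := hC.exists_dist_eq hconn hG hC' hdisj
  obtain ⟨s, hs, hseq⟩ := hC'.exists_dist_eq hconn hG hC fun y h h' => hdisj y h' h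
  have e := hC.dist_add_dist_le hconn hy (z := s) (fun h => hdisj _ h hs)
  have hpos := hconn.pos_dist_of_ne hab
  have := dist_four_point hconn hG y s a b
  rw [G.dist_comm (u := a) (v := s), G.dist_comm (u := b) (v := s)] at e
  rw [← dist_eq_one_iff_adj]
  have t := hconn.dist_triangle (u := y) (v := a) (w := s)
  rw [G.dist_comm (u := a) (v := s)] at t
  omega

theorem IsFullSide.exists_common_neighbor (hconn : G.Connected) (hG : DistLorentzian G)
    (hab : a ≠ b) (hC : IsFullSide G a b C) (hC' : IsFullSide G a b C')
    (hdisj : ∀ y, C y → ¬ C' y) : ∃ p, C p ∧ G.Adj p a ∧ G.Adj p b := by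
  have hadj := hC.adj hconn hG hab hC' hdisj
  obtain ⟨y, hy, hyeq⟩ := hC.exists_dist_eq hconn hG hC' hdisj
  have hpos := hconn.pos_dist_of_ne (u := y) (v := a) fun h => hC.not_left (h ▸ hy)
  obtain ⟨z, haz, hz⟩ := hconn.exists_adj_dist_eq (u := a) (v := y) (k := G.dist y a - 1)
    (by rw [G.dist_comm]; omega)
  rw [G.dist_comm] at hz
  refine ⟨z, ?_, haz.symm, adj_of_dist_eq hconn hG hadj haz.symm hyeq (by omega)⟩
  by_contra hzC
  have := hC.dist_add_dist_le hconn hy hzC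
  omega

theorem IsFullSide.isClique_neighborSet (hconn : G.Connected) (hG : DistLorentzian G)
    (hab : G.Adj a b) (hC : IsFullSide G a b C) {q w : V} (hq : C q) (hqa : G.Adj q a)
    (hqb : G.Adj q b) (hw : ¬ C w) (hwa : G.Adj w a) (hwb : G.Adj w b) :
    IsSimplicial G w := by
  have hwq : ¬ G.Adj q w := fun h => hw (hC.closed hq h hwa.ne hwb.ne)
  have hwqne : w ≠ q := fun h => hw (h ▸ hq)
  have dwq := hconn.dist_eq_two hwa hqa.symm hwqne fun h => hwq h.symm
  have hout : ∀ c, G.Adj w c → c ≠ a → c ≠ b → ¬ C c := fun c hc ha hb h =>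
    hw (hC.closed h hc.symm hwa.ne hwb.ne)
  have hqc : ∀ c, ¬ C c → c ≠ a → c ≠ b → ¬ G.Adj q c ∧ c ≠ q := fun c hc ha hb =>
    ⟨fun h => hc (hC.closed hq h ha hb), fun h => hc (h ▸ hq)⟩
  have hboth : ∀ c, G.Adj w c → c ≠ a → c ≠ b → G.Adj c a ∧ G.Adj c b := by
    intro c hwc hca hcb
    have hcC := hout c hwc hca hcb
    obtain ⟨nqc, ncq⟩ := hqc c hcC hca hcb
    by_cases h1 : G.Adj c a
    · refine ⟨h1, by_contra fun h2 => ?_⟩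
      exact not_gem hconn hG hwc.symm hwb hqb.symm h2 (fun h => hwq h.symm) (fun h => nqc h.symm)
        hcb hwqne ncq h1.symm hqa.symm
    by_cases h2 : G.Adj c b
    · exact (not_gem hconn hG hwc.symm hwa hqa.symm h1 (fun h => hwq h.symm)
        (fun h => nqc h.symm) hca hwqne ncq h2.symm hqb.symm).elim
    exfalso
    have d1 := hconn.dist_eq_two hwc.symm hwa hca h1
    have d2 := hconn.dist_eq_two hwc.symm hwb hcb h2
    refine not_pendant_diamond hG hab hwa hwb hqa hqb hwc.symm dwq d1 d2 ?_
    have d3 := hC.dist_add_dist_le hconn hq hcC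
    have d4 := hconn.dist_le_dist_add_one c hqa
    rw [dist_eq_one_iff_adj.2 hqa, dist_eq_one_iff_adj.2 hqb, G.dist_comm (v := c),
      G.dist_comm (v := c), G.dist_comm (v := c)] at d3
    omega
  have hcl : ∀ c d, G.Adj w c → G.Adj w d → c ≠ d → c ≠ a → c ≠ b → d ≠ a → d ≠ b →
      G.Adj c d := by
    intro c d hwc hwd hne hca hcb hda hdb
    by_contra hn
    obtain ⟨h1, h2⟩ := hboth c hwc hca hcb
    obtain ⟨h3, h4⟩ := hboth d hwd hda hdb
    obtain ⟨n1, n2⟩ := hqc c (hout c hwc hca hcb) hca hcb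
    obtain ⟨n3, n4⟩ := hqc d (hout d hwd hda hdb) hda hdb
    exact not_three_common_neighbors hG hab h1 h2 h3 h4 hqa hqb
      (hconn.dist_eq_two hwc.symm hwd hne hn)
      (hconn.dist_eq_two h1 hqa.symm n2 fun h => n1 h.symm)
      (hconn.dist_eq_two h3 hqa.symm n4 fun h => n3 h.symm)
  intro c hc d hd hne
  rw [mem_neighborSet] at hc hd
  by_cases hca : c = a
  · subst hca
    by_cases hdb : d = b
    · exact hdb ▸ hab
    · exact (hboth d hd hne.symm hdb).1.symm
  by_cases hcb : c = b
  · subst hcb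
    by_cases hda : d = a
    · exact hda ▸ hab.symm
    · exact (hboth d hd hda hne.symm).2.symm
  by_cases hda : d = a
  · exact hda ▸ (hboth c hc hca hcb).1
  by_cases hdb : d = b
  · exact hdb ▸ (hboth c hc hca hcb).2
  exact hcl c d hc hd hne hca hcb hda hdb

end Separator

/-- A connected graph with `λ₂ < -1/2` is Ptolemaic; if moreover it has a minimal
vertex separator of cardinality 2, then it contains the full house or the diamond
as an induced subgraph, and every vertex adjacent to both vertices of a minimal
vertex separator of cardinality 2 is simplicial. -/
theorem stmt_5 {V : Type*} [Fintype V] [DecidableEq V] (G : SimpleGraph V)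
    (hcard : 2 ≤ Fintype.card V) (hconn : G.Connected)
    (hlam : lambda2 G < -1/2) :
    IsPtolemaic G ∧
    ((∃ S : Finset V, S.card = 2 ∧ IsMinimalVertexSeparator G S) →
      ((HasInducedSubgraph G fullHouse ∨ HasInducedSubgraph G diamondGraph) ∧
        ∀ S : Finset V, S.card = 2 → IsMinimalVertexSeparator G S →
          ∀ v : V, (∀ a ∈ S, G.Adj v a) → IsSimplicial G v)) := by
  have hG := distLorentzian_of_lambda2_lt G hcard hlam
  refine ⟨isPtolemaic_of_distLorentzian hconn hG, ?_⟩
  rintro ⟨S, hS2, hS⟩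
  refine ⟨.inr ?_, ?_⟩
  · obtain ⟨a, b, hab, -, C, C', hC, hC', hdisj⟩ :=
      exists_isFullSide_of_isMinimalVertexSeparator hS2 hS
    obtain ⟨p, hp, hpa, hpb⟩ := hC.exists_common_neighbor hconn hG hab hC' hdisj
    obtain ⟨q, hq, hqa, hqb⟩ :=
      hC'.exists_common_neighbor hconn hG hab hC fun y h h' => hdisj y h' h
    refine hasInducedSubgraph_diamond (hC.adj hconn hG hab hC' hdisj) hpa hpb hqa hqb ?_ ?_
    · exact fun h => hdisj q (hC.closed hp h hqa.ne hqb.ne) hq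
    · rintro rfl
      exact hdisj p hp hq
  · intro S hS2 hS w hw
    obtain ⟨a, b, hab, rfl, C, C', hC, hC', hdisj⟩ :=
      exists_isFullSide_of_isMinimalVertexSeparator hS2 hS
    have hadj := hC.adj hconn hG hab hC' hdisj
    have hwa := hw a (by simp)
    have hwb := hw b (by simp)
    by_cases hwC : C w
    · obtain ⟨q, hq, hqa, hqb⟩ :=
        hC'.exists_common_neighbor hconn hG hab hC fun y h h' => hdisj y h' h
      exact hC'.isClique_neighborSet hconn hG hadj hq hqa hqb (hdisj w hwC) hwa hwb
    · obtain ⟨q, hq, hqa, hqb⟩ := hC.exists_common_neighbor hconn hG hab hC' hdisj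
      exact hC.isClique_neighborSet hconn hG hadj hq hqa hqb hwC hwa hwb
end

section
/- Let G be a finite connected chordal simple graph with at least one minimal vertex separator of cardinality 2. If the second largest distance eigenvalue of G satisfies λ2(G) < −1/2, then the diameter of G is at most 3. -/
open Polynomial SimpleGraph Sum

/-- All but one of the distance eigenvalues are at most `λ₂`. -/
theorem exists_forall_ne_eigenvalues_le_lambda2 {V : Type*} [Fintype V] [DecidableEq V]
    (G : SimpleGraph V) (hcard : 2 ≤ Fintype.card V) :
    ∃ i₀, ∀ i, i ≠ i₀ → (distMatrix_isHermitian G).eigenvalues i ≤ lambda2 G := by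
  set hA := distMatrix_isHermitian G
  have hsort : (distMatrix G).charpoly.roots.sort (· ≤ ·)
      = List.ofFn fun i => hA.eigenvalues₀ i.rev := by
    have hperm : ((distMatrix G).charpoly.roots.sort (· ≤ ·)).Perm <|
        List.ofFn (fun i => hA.eigenvalues₀ i.rev) := by
      refine List.Perm.trans ?_ (Equiv.Perm.ofFn_comp_perm Fin.revPerm hA.eigenvalues₀).symm
      rw [← Multiset.coe_eq_coe, Multiset.sort_eq, hA.roots_charpoly_eq_eigenvalues₀,
        Fin.univ_val_map]
      rfl
    refine hperm.eq_of_pairwise (le := (· ≤ ·)) (fun _ _ _ _ => le_antisymm)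
      (Multiset.pairwise_sort _ _) ?_
    rw [List.pairwise_ofFn]
    intro i j hij
    exact hA.eigenvalues₀_antitone (Fin.rev_le_rev.2 hij.le)
  have hl : lambda2 G = hA.eigenvalues₀ ⟨1, hcard⟩ := by
    have h2 : Fintype.card V - 2 < Fintype.card V := by omega
    rw [lambda2, hsort, List.getD_eq_getElem _ _ (by simpa using h2), List.getElem_ofFn]
    congr 1
    ext
    simp [Fin.rev]
    omega
  let e := Fintype.equivOfCardEq (Fintype.card_fin (Fintype.card V)) (β := V)
  refine ⟨e ⟨0, by omega⟩, fun i hi => ?_⟩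
  rw [hl]
  refine hA.eigenvalues₀_antitone ?_
  have : e.symm i ≠ ⟨0, by omega⟩ := fun h => hi (by rw [← h]; simp)
  rw [Fin.le_def]
  have h3 : (e.symm i : ℕ) ≠ 0 := fun h => this (Fin.ext h)
  exact Nat.one_le_iff_ne_zero.2 h3

open Matrix in
theorem Matrix.IsHermitian.dotProduct_mulVec_eq_sum {n : Type*} [Fintype n]
    [DecidableEq n] {A : Matrix n n ℝ} (hA : A.IsHermitian) (f : n → ℝ) :
    f ⬝ᵥ A *ᵥ f = ∑ i, hA.eigenvalues i * ((hA.eigenvectorBasis i : n → ℝ) ⬝ᵥ f) ^ 2 := by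
  have h := hA.eigenvectorBasis.sum_inner_mul_inner (WithLp.toLp 2 f) (WithLp.toLp 2 (A *ᵥ f))
  simp only [EuclideanSpace.inner_eq_star_dotProduct, star_trivial] at h
  rw [dotProduct_comm, ← h]
  refine Finset.sum_congr rfl fun i _ => ?_
  have : (A *ᵥ f) ⬝ᵥ (hA.eigenvectorBasis i : n → ℝ)
      = hA.eigenvalues i * ((hA.eigenvectorBasis i : n → ℝ) ⬝ᵥ f) := by
    rw [dotProduct_comm, dotProduct_mulVec, ← mulVec_transpose,
      show Aᵀ = A by simpa using hA.eq, hA.mulVec_eigenvectorBasis]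
    simp
  rw [this]
  ring

open Matrix in
theorem Matrix.IsHermitian.dotProduct_self_eq_sum {n : Type*} [Fintype n]
    [DecidableEq n] {A : Matrix n n ℝ} (hA : A.IsHermitian) (f : n → ℝ) :
    f ⬝ᵥ f = ∑ i, ((hA.eigenvectorBasis i : n → ℝ) ⬝ᵥ f) ^ 2 := by
  have h := hA.eigenvectorBasis.sum_inner_mul_inner (WithLp.toLp 2 f) (WithLp.toLp 2 f)
  simp only [EuclideanSpace.inner_eq_star_dotProduct, star_trivial] at h
  rw [← h]
  refine Finset.sum_congr rfl fun i _ => ?_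
  rw [dotProduct_comm f]
  ring

open Matrix in
/-- If `λ₂ < -1/2`, the form of `2 D + I` is negative at every vector orthogonal to the unit
vector of a vertex `a`, unless the vector vanishes off `a`. -/
theorem form_neg_of_lambda2_lt {V : Type*} [Fintype V] [DecidableEq V] {G : SimpleGraph V}
    (hcard : 2 ≤ Fintype.card V) (hlam : lambda2 G < -1/2) {a x : V} {g : V → ℝ}
    (hga : ((2 : ℝ) • distMatrix G + 1) a ⬝ᵥ g = 0) (hxa : x ≠ a) (hgx : g x ≠ 0) :
    g ⬝ᵥ ((2 : ℝ) • distMatrix G + 1) *ᵥ g < 0 := by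
  by_contra! hg
  obtain ⟨i₀, hi₀⟩ := exists_forall_ne_eigenvalues_le_lambda2 G hcard
  set hA := distMatrix_isHermitian G
  have hneg : ∀ f : V → ℝ, (hA.eigenvectorBasis i₀ : V → ℝ) ⬝ᵥ f = 0 → f ≠ 0 →
      f ⬝ᵥ ((2 : ℝ) • distMatrix G + 1) *ᵥ f < 0 := by
    intro f hf hf0
    have hpos : 0 < f ⬝ᵥ f := by
      have := dotProduct_star_self_pos_iff.2 hf0
      simpa using this
    have hle : f ⬝ᵥ distMatrix G *ᵥ f ≤ lambda2 G * (f ⬝ᵥ f) := by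
      rw [hA.dotProduct_mulVec_eq_sum, hA.dotProduct_self_eq_sum, Finset.mul_sum]
      refine Finset.sum_le_sum fun i _ => ?_
      rcases eq_or_ne i i₀ with rfl | hi
      · simp [hf]
      · exact mul_le_mul_of_nonneg_right (hi₀ i hi) (sq_nonneg _)
    rw [add_mulVec, smul_mulVec, one_mulVec, dotProduct_add, dotProduct_smul, smul_eq_mul]
    nlinarith
  set p := (hA.eigenvectorBasis i₀ : V → ℝ) a
  set q := (hA.eigenvectorBasis i₀ : V → ℝ) ⬝ᵥ g
  have hsymm : ((2 : ℝ) • distMatrix G + 1)ᵀ = (2 : ℝ) • distMatrix G + 1 := by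
    rw [transpose_add, transpose_smul, transpose_one, show (distMatrix G)ᵀ = _ by simpa using hA.eq]
  have haa : ((2 : ℝ) • distMatrix G + 1) a a = 1 := by simp [distMatrix]
  have hMg : (((2 : ℝ) • distMatrix G + 1) *ᵥ g) a = 0 := hga
  have hgM : g ⬝ᵥ ((2 : ℝ) • distMatrix G + 1).col a = 0 := by
    rw [← hga, dotProduct_comm]
    congr 1
    ext j
    exact congrFun (congrFun hsymm a) j
  have key : ∀ s t : ℝ, (s • Pi.single a 1 + t • g) ⬝ᵥ ((2 : ℝ) • distMatrix G + 1) *ᵥ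
      (s • Pi.single a 1 + t • g) = s ^ 2 + t ^ 2 * (g ⬝ᵥ ((2 : ℝ) • distMatrix G + 1) *ᵥ g) := by
    intro s t
    simp only [mulVec_add, mulVec_smul, dotProduct_add, add_dotProduct, smul_dotProduct,
      dotProduct_smul, mulVec_single_one, single_one_dotProduct, hMg, hgM, smul_eq_mul]
    rw [col_apply, haa]
    ring
  have hq : ∀ s t : ℝ, s * p + t * q = 0 → s • Pi.single a 1 + t • g ≠ 0 → False := by
    intro s t h0 hne
    have := hneg _ (by simpa [dotProduct_add, dotProduct_smul, p, q] using h0) hne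
    rw [key] at this
    nlinarith [mul_nonneg (sq_nonneg t) hg, sq_nonneg s]
  by_cases hp : p = 0
  · refine hq 1 0 ?_ ?_
    · rw [hp]; ring
    · intro h
      simpa using congrFun h a
  · refine hq q (-p) (by ring) fun h => ?_
    have := congrFun h x
    simp [hxa, hp, hgx] at this

/-- Adjacent vertices of a shortest walk are consecutive on it. -/
theorem SimpleGraph.Walk.mem_edges_of_length_eq_dist {V : Type*} {G : SimpleGraph V}
    {a b x y : V} {p : G.Walk a b} (hp : p.length = G.dist a b) (hx : x ∈ p.support)
    (hy : y ∈ p.support) (hxy : G.Adj x y) : s(x, y) ∈ p.edges := by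
  obtain ⟨i, rfl, hi⟩ := Walk.mem_support_iff_exists_getVert.1 hx
  obtain ⟨j, rfl, hj⟩ := Walk.mem_support_iff_exists_getVert.1 hy
  wlog hij : i ≤ j generalizing i j
  · rw [Sym2.eq_swap]
    exact this j hj hy i hi hx hxy.symm (by omega)
  have hne : i ≠ j := fun h => hxy.ne (by rw [h])
  have hd := G.dist_le ((p.take i).append (.cons hxy (p.drop j)))
  simp only [Walk.length_append, Walk.take_length, Walk.length_cons, Walk.drop_length] at hd
  obtain rfl : j = i + 1 := by omega
  exact (Walk.mk_mem_edges_iff_exists p).2 ⟨i, by omega, rfl⟩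

/-- Two vertices `a`, `b` with neighbours in a connected set `R` are joined through `R` by a path
whose only possible chord is `ab`. -/
theorem exists_walk_through {V : Type*} {G : SimpleGraph V} {R : Set V} {a b u x y : V}
    (ha : a ∉ R) (hb : b ∉ R) (hab : a ≠ b)
    (hR : ∀ z ∈ R, Relation.ReflTransGen (fun z w => G.Adj z w ∧ z ∈ R ∧ w ∈ R) u z)
    (hx : x ∈ R) (hy : y ∈ R) (hxa : G.Adj x a) (hyb : G.Adj y b) :
    ∃ p : G.Walk a b, p.IsPath ∧ 2 ≤ p.length ∧ (∀ z ∈ p.support, z = a ∨ z = b ∨ z ∈ R) ∧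
      s(a, b) ∉ p.edges ∧
      ∀ z w, z ∈ p.support → w ∈ p.support → G.Adj z w → s(z, w) ≠ s(a, b) → s(z, w) ∈ p.edges := by
  let H : SimpleGraph V :=
    { Adj := fun z w => G.Adj z w ∧ (z = a ∨ z = b ∨ z ∈ R) ∧ (w = a ∨ w = b ∨ w ∈ R) ∧
        s(z, w) ≠ s(a, b)
      symm := ⟨fun z w h => ⟨h.1.symm, h.2.2.1, h.2.1, by rw [Sym2.eq_swap]; exact h.2.2.2⟩⟩
      loopless := ⟨fun z h => h.1.ne rfl⟩ }
  have hHG : H ≤ G := fun z w h => h.1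
  have hne : ∀ z ∈ R, ∀ w, s(z, w) ≠ s(a, b) := by
    intro z hz w h
    rcases Sym2.eq_iff.1 h with ⟨rfl, -⟩ | ⟨rfl, -⟩
    · exact ha hz
    · exact hb hz
  have hreach : ∀ z ∈ R, H.Reachable u z := by
    intro z hz
    rw [SimpleGraph.reachable_iff_reflTransGen]
    exact Relation.ReflTransGen.mono (fun z w h =>
      ⟨h.1, .inr (.inr h.2.1), .inr (.inr h.2.2), hne z h.2.1 w⟩) _ _ (hR z hz)
  have hHxa : H.Adj x a := ⟨hxa, .inr (.inr hx), .inl rfl, hne x hx a⟩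
  have hHyb : H.Adj y b := ⟨hyb, .inr (.inr hy), .inr (.inl rfl), hne y hy b⟩
  have hab' : H.Reachable a b :=
    hHxa.symm.reachable.trans (((hreach x hx).symm.trans (hreach y hy)).trans hHyb.reachable)
  obtain ⟨p, hp, hpd⟩ := hab'.exists_path_of_dist
  have hnadj : ¬ H.Adj a b := fun h => h.2.2.2 rfl
  have hsupp : ∀ z ∈ p.support, z = a ∨ z = b ∨ z ∈ R := by
    intro z hz
    have hnil : ¬ p.Nil := fun h => hab h.eq
    obtain ⟨e, he, hze⟩ := (SimpleGraph.Walk.mem_support_iff_exists_mem_edges_of_not_nil hnil).1 hz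
    obtain ⟨w, rfl⟩ := Sym2.mem_iff_exists.1 hze
    exact (p.adj_of_mem_edges he).2.1
  refine ⟨p.mapLe hHG, hp.mapLe hHG, ?_, ?_, ?_, ?_⟩
  · have := hab'.one_lt_dist_of_ne_of_not_adj hab hnadj
    simpa [hpd, Nat.succ_le_iff] using this
  · simpa using hsupp
  · rw [Walk.edges_mapLe_eq_edges]
    exact fun h => hnadj (p.adj_of_mem_edges h)
  · simp only [Walk.support_mapLe_eq_support, Walk.edges_mapLe_eq_edges]
    intro z w hz hw hzw hne
    exact Walk.mem_edges_of_length_eq_dist hpd hz hw ⟨hzw, hsupp z hz, hsupp w hw, hne⟩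

/-- The vertices reachable from `u` in `G - S`. -/
def reachAvoiding {V : Type*} (G : SimpleGraph V) (S : Finset V) (u : V) : Set V :=
  {x | Relation.ReflTransGen (fun z w => G.Adj z w ∧ w ∉ S) u x}

section reachAvoiding

variable {V : Type*} {G : SimpleGraph V} {S : Finset V} {u v x y : V}

theorem mem_reachAvoiding_self : u ∈ reachAvoiding G S u := Relation.ReflTransGen.refl

theorem mem_reachAvoiding_of_adj (hx : x ∈ reachAvoiding G S u) (h : G.Adj x y) (hy : y ∉ S) :
    y ∈ reachAvoiding G S u := Relation.ReflTransGen.tail hx ⟨h, hy⟩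

theorem notMem_of_mem_reachAvoiding (hu : u ∉ S) (hx : x ∈ reachAvoiding G S u) : x ∉ S := by
  cases hx with
  | refl => exact hu
  | tail _ h => exact h.2

theorem reflTransGen_of_mem_reachAvoiding (hx : x ∈ reachAvoiding G S u) :
    Relation.ReflTransGen (fun z w => G.Adj z w ∧ z ∈ reachAvoiding G S u ∧
      w ∈ reachAvoiding G S u) u x := by
  induction hx with
  | refl => exact .refl
  | tail h h' ih => exact ih.tail ⟨h'.1, h, mem_reachAvoiding_of_adj h h'.1 h'.2⟩

theorem mem_reachAvoiding_of_mem_of_mem (hv : v ∉ S) (hx : x ∈ reachAvoiding G S u)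
    (hx' : x ∈ reachAvoiding G S v) : v ∈ reachAvoiding G S u := by
  induction hx' with
  | refl => exact hx
  | tail h h' ih =>
    exact ih (mem_reachAvoiding_of_adj hx h'.1.symm (notMem_of_mem_reachAvoiding hv h))

theorem IsUVSeparator.notMem_reachAvoiding (h : IsUVSeparator G S u v) :
    v ∉ reachAvoiding G S u := by
  intro hv
  have : ∃ w : G.Walk u v, ∀ x ∈ w.support, x ∉ S := by
    replace h := h.1
    induction hv with
    | refl => exact ⟨.nil, by simpa using h⟩
    | tail _ h' ih =>
      obtain ⟨w, hw⟩ := ih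
      refine ⟨w.concat h'.1, ?_⟩
      simp only [Walk.support_concat, List.mem_append, List.mem_singleton]
      rintro x (hx | rfl)
      exacts [hw x hx, h'.2]
  obtain ⟨w, hw⟩ := this
  obtain ⟨x, hx, hxS⟩ := h.2.2 w
  exact hw x hx hxS

theorem exists_adj_of_walk {a b : V} (hS : ∀ z ∈ S, z = a ∨ z = b) (hv : v ∉ reachAvoiding G S u)
    (w : G.Walk x v) (hx : x ∈ reachAvoiding G S u) (hb : b ∉ w.support) :
    ∃ y ∈ reachAvoiding G S u, G.Adj y a := by
  induction w with
  | nil => exact absurd hx hv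
  | @cons x z v h p ih =>
    by_cases hz : z ∈ S
    · rcases hS z hz with rfl | rfl
      · exact ⟨x, hx, h⟩
      · simp at hb
    · exact ih hv (mem_reachAvoiding_of_adj hx h hz) (by simp_all)

end reachAvoiding

theorem IsUVSeparator.symm {V : Type*} {G : SimpleGraph V} {S : Finset V} {u v : V}
    (h : IsUVSeparator G S u v) : IsUVSeparator G S v u :=
  ⟨h.2.1, h.1, fun w => by simpa using h.2.2 w.reverse⟩

/-- The path through the component of `u` given by a minimal `uv`-separator `{a, b}`. -/
theorem exists_walk_of_minimal_separator {V : Type*} [DecidableEq V] {G : SimpleGraph V}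
    {a b u v : V} (hab : a ≠ b) (hsep : IsUVSeparator G {a, b} u v)
    (hmin : ∀ T : Finset V, T ⊂ {a, b} → ¬ IsUVSeparator G T u v) :
    ∃ p : G.Walk a b, p.IsPath ∧ 2 ≤ p.length ∧
      (∀ z ∈ p.support, z = a ∨ z = b ∨ z ∈ reachAvoiding G {a, b} u) ∧ s(a, b) ∉ p.edges ∧
      ∀ z w, z ∈ p.support → w ∈ p.support → G.Adj z w → s(z, w) ≠ s(a, b) → s(z, w) ∈ p.edges := by
  have hv := hsep.notMem_reachAvoiding
  have hu := hsep.1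
  have hwalk : ∀ c ∈ ({a, b} : Finset V), ∃ w : G.Walk u v, c ∉ w.support := by
    intro c hc
    have hlt : ({c} : Finset V) ⊂ {a, b} := by
      refine Finset.ssubset_iff_subset_ne.2 ⟨by simpa using hc, fun h => ?_⟩
      have := congrArg Finset.card h
      simp [Finset.card_pair hab] at this
    by_contra! h
    refine hmin _ hlt ⟨?_, ?_, fun w => ⟨c, h w, by simp⟩⟩
    · rintro h
      rw [Finset.mem_singleton.1 h] at hu
      exact hu hc
    · rintro h
      exact hsep.2.1 (by rwa [Finset.mem_singleton.1 h])
  obtain ⟨w₁, hw₁⟩ := hwalk a (by simp)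
  obtain ⟨w₂, hw₂⟩ := hwalk b (by simp)
  obtain ⟨x, hx, hxa⟩ :=
    exists_adj_of_walk (a := a) (b := b) (by simp) hv w₂ mem_reachAvoiding_self hw₂
  obtain ⟨y, hy, hyb⟩ :=
    exists_adj_of_walk (a := b) (by simp [or_comm]) hv w₁ mem_reachAvoiding_self hw₁
  exact exists_walk_through (fun h => notMem_of_mem_reachAvoiding hu h (by simp))
    (fun h => notMem_of_mem_reachAvoiding hu h (by simp)) hab
    (fun z hz => reflTransGen_of_mem_reachAvoiding hz) hx hy hxa hyb

theorem SimpleGraph.Walk.IsPath.isCycle_append_reverse {V : Type*} {G : SimpleGraph V}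
    {a b : V} {p q : G.Walk a b} (hp : p.IsPath) (hq : q.IsPath) (hab : a ≠ b)
    (hpq : ∀ z ∈ p.support, z ∈ q.support → z = a ∨ z = b) (he : s(a, b) ∉ p.edges) :
    (p.append q.reverse).IsCycle := by
  rw [Walk.isCycle_def, Walk.isTrail_def, Walk.edges_append, Walk.tail_support_append]
  refine ⟨?_, ?_, ?_⟩
  · refine hp.isTrail.edges_nodup.append hq.reverse.isTrail.edges_nodup ?_
    intro e hep heq
    rw [Walk.edges_reverse, List.mem_reverse] at heq
    induction e with | _ z w => ?_
    have hzw := (p.adj_of_mem_edges hep).ne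
    have hz := hpq z (p.fst_mem_support_of_mem_edges hep) (q.fst_mem_support_of_mem_edges heq)
    have hw := hpq w (p.snd_mem_support_of_mem_edges hep) (q.snd_mem_support_of_mem_edges heq)
    rcases hz with rfl | rfl <;> rcases hw with rfl | rfl
    · exact hzw rfl
    · exact he hep
    · exact he (Sym2.eq_swap ▸ hep)
    · exact hzw rfl
  · intro h
    have := congrArg Walk.length h
    have hp0 : p.length ≠ 0 := fun h => hab (Walk.eq_of_length_eq_zero h)
    simp [hp0] at this
  · refine hp.support_nodup.tail.append hq.reverse.support_nodup.tail ?_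
    intro z hzp hzq
    have h1 := hp.support_nodup
    have h2 := hq.reverse.support_nodup
    rw [← Walk.cons_tail_support, List.nodup_cons] at h1 h2
    rcases hpq z (List.mem_of_mem_tail hzp) (by simpa using List.mem_of_mem_tail hzq)
      with rfl | rfl
    · exact h1.1 hzp
    · exact h2.1 hzq

/-- In a chordal graph, an edge `ab` and a path from `a` to `b` whose only possible chord is `ab`
form a triangle. -/
theorem IsChordal.exists_common_neighbor {V : Type*} {G : SimpleGraph V} (hG : IsChordal G)
    {a b : V} (hab : G.Adj a b) {p : G.Walk a b} (hp : p.IsPath) (hlen : 2 ≤ p.length)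
    (he : s(a, b) ∉ p.edges)
    (hind : ∀ z w, z ∈ p.support → w ∈ p.support → G.Adj z w → s(z, w) ≠ s(a, b) →
      s(z, w) ∈ p.edges) :
    ∃ c ∈ p.support, G.Adj c a ∧ G.Adj c b := by
  have hc : (Walk.cons hab.symm p).IsCycle :=
    (Walk.cons_isCycle_iff _ _).2 ⟨hp, by rwa [Sym2.eq_swap]⟩
  obtain h2 | h3 : p.length = 2 ∨ 3 ≤ p.length := by omega
  · refine ⟨p.getVert 1, p.getVert_mem_support 1, ?_, ?_⟩
    · have := p.adj_getVert_succ (i := 0) (by omega)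
      simpa using this.symm
    · have := p.adj_getVert_succ (i := 1) (by omega)
      rwa [show 1 + 1 = p.length from h2.symm, p.getVert_length] at this
  · obtain ⟨z, w, hz, hw, hzw, hn⟩ := hG b _ hc (by simpa using h3)
    have hz' : z ∈ p.support := by
      rcases List.mem_cons.1 (Walk.support_cons _ _ ▸ hz) with rfl | h
      exacts [p.end_mem_support, h]
    have hw' : w ∈ p.support := by
      rcases List.mem_cons.1 (Walk.support_cons _ _ ▸ hw) with rfl | h
      exacts [p.end_mem_support, h]
    rw [Walk.edges_cons, List.mem_cons, not_or] at hn
    exact absurd (hind z w hz' hw' hzw (by rw [Sym2.eq_swap (a := a)]; exact hn.1)) hn.2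

/-- A minimal separator of size two in a chordal graph is an edge of an induced diamond. -/
theorem IsChordal.exists_diamond {V : Type*} [DecidableEq V] {G : SimpleGraph V}
    (hG : IsChordal G) {S : Finset V} (hS : S.card = 2) (hmvs : IsMinimalVertexSeparator G S) :
    ∃ a b c d : V, G.Adj a b ∧ G.Adj c a ∧ G.Adj c b ∧ G.Adj d a ∧ G.Adj d b ∧ c ≠ d ∧
      ¬ G.Adj c d := by
  obtain ⟨a, b, hab, rfl⟩ := Finset.card_eq_two.1 hS
  obtain ⟨u, v, -, -, hsep, hmin⟩ := hmvs
  obtain ⟨p, hp, hpl, hps, hpe, hpi⟩ := exists_walk_of_minimal_separator hab hsep hmin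
  obtain ⟨q, hq, hql, hqs, hqe, hqi⟩ := exists_walk_of_minimal_separator hab hsep.symm
    fun T hT h => hmin T hT h.symm
  have hv := hsep.notMem_reachAvoiding
  have hdisj : ∀ z ∈ reachAvoiding G {a, b} u, z ∉ reachAvoiding G {a, b} v := fun z hz hz' =>
    hv (mem_reachAvoiding_of_mem_of_mem hsep.2.1 hz hz')
  have hnadj : ∀ z ∈ reachAvoiding G {a, b} u, ∀ w ∈ reachAvoiding G {a, b} v, ¬ G.Adj z w :=
    fun z hz w hw h => hdisj w
      (mem_reachAvoiding_of_adj hz h (notMem_of_mem_reachAvoiding hsep.2.1 hw)) hw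
  have hadj : G.Adj a b := by
    by_contra hn
    have hne : ∀ z w, G.Adj z w → s(z, w) ≠ s(a, b) := by
      intro z w h he
      rw [← SimpleGraph.mem_edgeSet, he, SimpleGraph.mem_edgeSet] at h
      exact hn h
    have hcyc := hp.isCycle_append_reverse hq hab (fun z hz hz' => by
      have := hps z hz
      have := hqs z hz'
      have := hdisj z
      tauto) hpe
    obtain ⟨z, w, hz, hw, hzw, he⟩ := hG a _ hcyc (by simp; omega)
    simp only [Walk.mem_support_append_iff, Walk.support_reverse, List.mem_reverse] at hz hw
    simp only [Walk.edges_append, Walk.edges_reverse, List.mem_append, List.mem_reverse,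
      not_or] at he
    have hP : ¬ (z ∈ p.support ∧ w ∈ p.support) := fun h => he.1 (hpi z w h.1 h.2 hzw (hne z w hzw))
    have hQ : ¬ (z ∈ q.support ∧ w ∈ q.support) := fun h => he.2 (hqi z w h.1 h.2 hzw (hne z w hzw))
    have hap := p.start_mem_support
    have hbp := p.end_mem_support
    have haq := q.start_mem_support
    have hbq := q.end_mem_support
    have hRu : ∀ z, z ∈ p.support → z ∉ q.support → z ∈ reachAvoiding G {a, b} u := by
      intro z hz hz'
      rcases hps z hz with rfl | rfl | h
      exacts [absurd haq hz', absurd hbq hz', h]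
    have hRv : ∀ z, z ∈ q.support → z ∉ p.support → z ∈ reachAvoiding G {a, b} v := by
      intro z hz hz'
      rcases hqs z hz with rfl | rfl | h
      exacts [absurd hap hz', absurd hbp hz', h]
    rcases hz with hz | hz
    · have hw' : w ∉ p.support := fun h => hP ⟨hz, h⟩
      have hwq := hw.resolve_left hw'
      exact hnadj z (hRu z hz fun h => hQ ⟨h, hwq⟩) w (hRv w hwq hw') hzw
    · have hw' : w ∉ q.support := fun h => hQ ⟨hz, h⟩
      have hwp := hw.resolve_right hw'
      exact hnadj w (hRu w hwp hw') z (hRv z hz fun h => hP ⟨h, hwp⟩) hzw.symm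
  obtain ⟨c, hc, hca, hcb⟩ := hG.exists_common_neighbor hadj hp hpl hpe hpi
  obtain ⟨d, hd, hda, hdb⟩ := hG.exists_common_neighbor hadj hq hql hqe hqi
  have hc' := ((hps c hc).resolve_left hca.ne).resolve_left hcb.ne
  have hd' := ((hqs d hd).resolve_left hda.ne).resolve_left hdb.ne
  exact ⟨a, b, c, d, hadj, hca, hcb, hda, hdb, fun h => hdisj c hc' (h ▸ hd'),
    hnadj c hc' d hd'⟩

section Diamond

variable {V : Type*} [Fintype V] [DecidableEq V] {G : SimpleGraph V} {a b c d x y : V}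

open Matrix in
/-- The form of `2 D + I` is negative on combinations of two vertices `x`, `y` with nonzero
coefficient at `x`, after projecting orthogonally to an induced diamond. -/
theorem diamond_form_neg (hcard : 2 ≤ Fintype.card V) (hlam : lambda2 G < -1/2)
    (hab : G.Adj a b) (hca : G.Adj c a) (hcb : G.Adj c b) (hda : G.Adj d a) (hdb : G.Adj d b)
    (hcd : c ≠ d) (hncd : G.dist c d = 2)
    (hxa : x ≠ a) (hxb : x ≠ b) (hxc : x ≠ c) (hxd : x ≠ d) (hya : y ≠ a) (hyb : y ≠ b)
    (hyc : y ≠ c) (hyd : y ≠ d) {s : ℝ} (hxy : x ≠ y ∨ s = 0) {α β γ δ α' β' γ' δ' ε : ℝ}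
    (h1 : G.dist x a = α) (h2 : G.dist x b = β) (h3 : G.dist x c = γ) (h4 : G.dist x d = δ)
    (h1' : G.dist y a = α') (h2' : G.dist y b = β') (h3' : G.dist y c = γ')
    (h4' : G.dist y d = δ')
    (h5 : 2 * G.dist x y + (if x = y then 1 else 0) = ε) :
    (1 + 2 * (α - β) ^ 2 + 2 / 3 * (γ - δ) ^ 2
        + 2 * (5 * (α + β) - 3 * (γ + δ)) * (α + β - γ - δ))
      + 2 * s * (ε + 2 * (α - β) * (α' - β') + 2 / 3 * (γ - δ) * (γ' - δ')
        + 10 * (α + β) * (α' + β') - 8 * ((α + β) * (γ' + δ') + (α' + β') * (γ + δ))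
        + 6 * (γ + δ) * (γ' + δ'))
      + s ^ 2 * (1 + 2 * (α' - β') ^ 2 + 2 / 3 * (γ' - δ') ^ 2
        + 2 * (5 * (α' + β') - 3 * (γ' + δ')) * (α' + β' - γ' - δ')) < 0 := by
  have key := form_neg_of_lambda2_lt (G := G) hcard hlam (a := a) (x := x)
    (g := ((α - β) + 5 * (α + β) - 4 * (γ + δ) + s * ((α' - β') + 5 * (α' + β') - 4 * (γ' + δ'))) •
        Pi.single a 1
      + ((β - α) + 5 * (α + β) - 4 * (γ + δ) + s * ((β' - α') + 5 * (α' + β') - 4 * (γ' + δ'))) •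
        Pi.single b 1
      + ((γ - δ) / 3 - 4 * (α + β) + 3 * (γ + δ)
        + s * ((γ' - δ') / 3 - 4 * (α' + β') + 3 * (γ' + δ'))) • Pi.single c 1
      + ((δ - γ) / 3 - 4 * (α + β) + 3 * (γ + δ)
        + s * ((δ' - γ') / 3 - 4 * (α' + β') + 3 * (γ' + δ'))) • Pi.single d 1
      + Pi.single x 1 + s • Pi.single y 1)
  have hd1 : ∀ {u v : V}, G.Adj u v → (G.dist u v : ℝ) = 1 ∧ (G.dist v u : ℝ) = 1 := fun h =>
    ⟨by exact_mod_cast SimpleGraph.dist_eq_one_iff_adj.2 h,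
      by exact_mod_cast SimpleGraph.dist_eq_one_iff_adj.2 h.symm⟩
  have hcd2 : (G.dist c d : ℝ) = 2 := by exact_mod_cast hncd
  have hdc2 : (G.dist d c : ℝ) = 2 := by rw [G.dist_comm]; exact hcd2
  have e1 := h1; rw [G.dist_comm] at e1
  have e2 := h2; rw [G.dist_comm] at e2
  have e3 := h3; rw [G.dist_comm] at e3
  have e4 := h4; rw [G.dist_comm] at e4
  have e1' := h1'; rw [G.dist_comm] at e1'
  have e2' := h2'; rw [G.dist_comm] at e2'
  have e3' := h3'; rw [G.dist_comm] at e3'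
  have e4' := h4'; rw [G.dist_comm] at e4'
  have e5 := h5; rw [G.dist_comm] at e5; simp only [eq_comm (a := x)] at e5
  have M : ∀ u v, ((2 : ℝ) • distMatrix G + 1) u v = 2 * G.dist u v + if u = v then 1 else 0 := by
    intro u v
    simp [distMatrix, one_apply]
  specialize key ?_ hxa ?_
  · simp only [dotProduct_add, dotProduct_smul, dotProduct_single_one, M, smul_eq_mul, hd1 hab,
      hd1 hca, hd1 hda, e1, e1', SimpleGraph.dist_self, hxa.symm, hya.symm, hab.ne, hca.ne.symm,
      hda.ne.symm, if_true, if_false]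
    push_cast
    ring
  · rcases hxy with hxy | rfl
    · simp [hxa, hxb, hxc, hxd, hxy]
    · simp [hxa, hxb, hxc, hxd]
  · simp only [mulVec_add, mulVec_smul, dotProduct_add, add_dotProduct, smul_dotProduct,
      dotProduct_smul, mulVec_single_one, single_one_dotProduct, col_apply, M, smul_eq_mul,
      hd1 hab, hd1 hca, hd1 hda, hd1 hcb, hd1 hdb, hcd2, hdc2, h1, h2, h3, h4, h1', h2', h3', h4',
      e1, e2, e3, e4, e1', e2', e3', e4', h5, e5, SimpleGraph.dist_self, hxa.symm, hya.symm,
      hab.ne, hca.ne.symm, hda.ne.symm, hxb.symm, hxc.symm, hxd.symm, hyb.symm, hyc.symm,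
      hyd.symm, hcb.ne.symm, hdb.ne.symm, hxa, hya, hab.ne.symm, hca.ne, hda.ne, hcb.ne, hdb.ne,
      hcd, hcd.symm, hxb, hxc, hxd, hyb, hyc, hyd, if_true, if_false] at key
    push_cast at key
    linear_combination key

/-- If `λ₂ < -1/2`, no vertex is at distance two from `{a, b}` through `a`, where `ab` is the
central edge of an induced diamond. -/
theorem diamond_no_far_vertex (hcard : 2 ≤ Fintype.card V) (hconn : G.Connected)
    (hlam : lambda2 G < -1/2)
    (hab : G.Adj a b) (hca : G.Adj c a) (hcb : G.Adj c b) (hda : G.Adj d a) (hdb : G.Adj d b)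
    (hcd : c ≠ d) (hncd : ¬ G.Adj c d) (hxa : x ≠ a) (hxb : x ≠ b) (hnxa : ¬ G.Adj x a)
    (hnxb : ¬ G.Adj x b) (hxy : G.Adj x y) (hya : G.Adj y a) : False := by
  have hxc : x ≠ c := fun h => hnxa (h ▸ hca)
  have hxd : x ≠ d := fun h => hnxa (h ▸ hda)
  have hyb : y ≠ b := fun h => hnxb (h ▸ hxy)
  have tri : ∀ u v w, G.dist u w ≤ G.dist u v + G.dist v w := fun u v w => hconn.dist_triangle
  have pos : ∀ {u v}, u ≠ v → 0 < G.dist u v := fun h => hconn.pos_dist_of_ne h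
  have one : ∀ {u v}, G.Adj u v → G.dist u v = 1 := SimpleGraph.dist_eq_one_iff_adj.2
  have hcd2 : G.dist c d = 2 := by
    have := hconn.one_lt_dist_of_ne_of_not_adj hcd hncd
    have := tri c a d
    rw [one hca, one hda.symm] at this
    omega
  have hF := fun s => diamond_form_neg (s := s) hcard hlam hab hca hcb hda hdb hcd hcd2 hxa hxb
    hxc hxd (y := y) hya.ne hyb
  have hx := diamond_form_neg hcard hlam hab hca hcb hda hdb hcd hcd2 hxa hxb hxc hxd hxa hxb hxc
    hxd (.inr rfl) rfl rfl rfl rfl rfl rfl rfl rfl rfl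
  have hα := hconn.one_lt_dist_of_ne_of_not_adj hxa hnxa
  have hβ := hconn.one_lt_dist_of_ne_of_not_adj hxb hnxb
  have hα2 := tri x y a
  have hβ1 := tri x a b
  have hγ0 := pos hxc
  have hγ1 := tri x a c
  have hγ2 := tri x b c
  have hγ3 := tri x c b
  have hδ0 := pos hxd
  have hδ1 := tri x a d
  have hδ2 := tri x b d
  have hδ3 := tri x d b
  rw [one hxy, one hya] at hα2
  rw [one hab] at hβ1
  rw [one hca.symm] at hγ1
  rw [one hcb.symm] at hγ2
  rw [one hcb] at hγ3
  rw [one hda.symm] at hδ1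
  rw [one hdb.symm] at hδ2
  rw [one hdb] at hδ3
  have hα3 : G.dist x a = 2 := by omega
  have hcases : (G.dist x b = 3 ∧ G.dist x c = 3 ∧ G.dist x d = 3) ∨
      (G.dist x b = 2 ∧ G.dist x c = 3 ∧ G.dist x d = 3) ∨
      (G.dist x b = 2 ∧ G.dist x c = 2 ∧ G.dist x d = 3) ∨
      (G.dist x b = 2 ∧ G.dist x c = 3 ∧ G.dist x d = 2) := by
    clear hF
    rw [hα3] at hx hβ1 hγ1 hδ1
    generalize G.dist x b = β at *
    generalize G.dist x c = γ at *
    generalize G.dist x d = δ at *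
    interval_cases β <;> interval_cases γ <;> interval_cases δ <;>
      first | omega | norm_num at hx
  have hyc : y ≠ c := by
    rintro rfl
    have := one hxy
    omega
  have hyd : y ≠ d := by
    rintro rfl
    have := one hxy
    omega
  have hF' := fun s => hF s hyc hyd (.inl hxy.ne) rfl rfl rfl rfl rfl rfl rfl rfl rfl
  have hβ0' := pos hyb
  have hβ1' := tri y a b
  have hβ2' := tri x y b
  have hγ0' := pos hyc
  have hγ1' := tri y a c
  have hγ2' := tri x y c
  have hδ0' := pos hyd
  have hδ1' := tri y a d
  have hδ2' := tri x y d
  rw [one hya, one hab] at hβ1'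
  rw [one hya, one hca.symm] at hγ1'
  rw [one hya, one hda.symm] at hδ1'
  rw [one hxy] at hβ2' hγ2' hδ2'
  simp only [one hxy, one hya, hα3, if_neg hxy.ne] at hF'
  have hF1 := hF' (-1)
  have hF2 := hF' (-2)
  clear hF hF' hx
  generalize G.dist y b = β at *
  generalize G.dist y c = γ at *
  generalize G.dist y d = δ at *
  rcases hcases with ⟨h1, h2, h3⟩ | ⟨h1, h2, h3⟩ | ⟨h1, h2, h3⟩ | ⟨h1, h2, h3⟩ <;>
    rw [h1, h2, h3] at hF1 hF2 <;>
    interval_cases β <;> interval_cases γ <;> interval_cases δ <;>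
      first
      | omega
      | (norm_num at hF1; done)
      | norm_num at hF2

/-- If `λ₂ < -1/2`, the central edge of an induced diamond is a dominating set. -/
theorem diamond_dominating (hcard : 2 ≤ Fintype.card V) (hconn : G.Connected)
    (hlam : lambda2 G < -1/2)
    (hab : G.Adj a b) (hca : G.Adj c a) (hcb : G.Adj c b) (hda : G.Adj d a) (hdb : G.Adj d b)
    (hcd : c ≠ d) (hncd : ¬ G.Adj c d) (z : V) : G.dist z a ≤ 1 ∨ G.dist z b ≤ 1 := by
  have hdist : ∀ {u v}, u = v ∨ G.Adj u v → G.dist u v ≤ 1 := by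
    rintro u v (rfl | h)
    · simp
    · exact (SimpleGraph.dist_eq_one_iff_adj.2 h).le
  suffices (z = a ∨ G.Adj z a) ∨ (z = b ∨ G.Adj z b) from this.imp hdist hdist
  have hw := hconn.preconnected a z
  rw [SimpleGraph.reachable_iff_reflTransGen] at hw
  induction hw with
  | refl => exact .inl (.inl rfl)
  | @tail y x _ hyx ih =>
    by_contra! h
    obtain ⟨⟨hxa, hnxa⟩, hxb, hnxb⟩ := h
    rcases ih with (rfl | hya) | (rfl | hyb)
    · exact hnxa hyx.symm
    · exact diamond_no_far_vertex hcard hconn hlam hab hca hcb hda hdb hcd hncd hxa hxb hnxa hnxb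
        hyx.symm hya
    · exact hnxb hyx.symm
    · exact diamond_no_far_vertex hcard hconn hlam hab.symm hcb hca hdb hda hcd hncd hxb hxa hnxb
        hnxa hyx.symm hyb

end Diamond

/-- A connected chordal graph with a minimal vertex separator of cardinality 2 and
`λ₂ < -1/2` has diameter at most 3. -/
theorem stmt_7 {V : Type*} [Fintype V] [DecidableEq V] (G : SimpleGraph V)
    (hcard : 2 ≤ Fintype.card V) (hconn : G.Connected) (hchordal : IsChordal G)
    (hmvs : ∃ S : Finset V, S.card = 2 ∧ IsMinimalVertexSeparator G S)
    (hlam : lambda2 G < -1/2) :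
    graphDiam G ≤ 3 := by
  obtain ⟨S, hS, hS'⟩ := hmvs
  obtain ⟨a, b, c, d, hab, hca, hcb, hda, hdb, hcd, hncd⟩ := hchordal.exists_diamond hS hS'
  refine Finset.sup_le fun p _ => ?_
  have hdom := diamond_dominating hcard hconn hlam hab hca hcb hda hdb hcd hncd
  have hab1 := SimpleGraph.dist_eq_one_iff_adj.2 hab
  have h1 : G.dist p.1 p.2 ≤ G.dist p.1 a + G.dist a p.2 := hconn.dist_triangle
  have h2 : G.dist p.1 p.2 ≤ G.dist p.1 b + G.dist b p.2 := hconn.dist_triangle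
  have h3 : G.dist p.1 b ≤ G.dist p.1 a + G.dist a b := hconn.dist_triangle
  have h4 : G.dist p.1 a ≤ G.dist p.1 b + G.dist b a := hconn.dist_triangle
  rw [G.dist_comm (u := b) (v := a)] at h4
  rw [G.dist_comm (u := a) (v := p.2)] at h1
  rw [G.dist_comm (u := b) (v := p.2)] at h2
  rcases hdom p.1 with h | h <;> rcases hdom p.2 with h' | h' <;> omega
end
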